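/- Let s ≥ 1, u_1,...,u_s ∈ k^*, α_0 ∈ Aff_3(k), and α_1,...,α_{s-1} ∈ Aff_3(k) \ B. Set θ := α_0 ∘ φ_{u_1} ∘ α_1 ∘ φ_{u_2} ∘ ··· ∘ φ_{u_{s-1}} ∘ α_{s-1} ∘ φ_{u_s}. Then the total degree of θ(x_i) is at least 9 for each i = 1,2,3. -/

import Mathlib

open MvPolynomial

noncomputable section

namespace YasudaPaper

variable {k : Type*} [Field k]

/-- `f := x1*x3 - x2^2` (variables: `X 0 = x1, X 1 = x2, X 2 = x3`). -/
def fP : MvPolynomial (Fin 3) k := X 0 * X 2 - X 1 ^ 2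

/-- `r := x2*f + x1^2`. -/
def rP : MvPolynomial (Fin 3) k := X 1 * fP + X 0 ^ 2

/-- `g := x3*f^2 + 2*x1*x2*f + x1^3`. -/
def gP : MvPolynomial (Fin 3) k := X 2 * fP ^ 2 + 2 * X 0 * X 1 * fP + X 0 ^ 3

/-- The Jacobian derivation `Δ = Δ_{(f,g)}`, `h ↦ det ∂(f,g,h)/∂(x1,x2,x3)`. -/
def Del (h : MvPolynomial (Fin 3) k) : MvPolynomial (Fin 3) k :=
  Matrix.det !![pderiv 0 fP, pderiv 1 fP, pderiv 2 fP;
                pderiv 0 gP, pderiv 1 gP, pderiv 2 gP;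
                pderiv 0 h,  pderiv 1 h,  pderiv 2 h]

/-- `φ = exp D`: for every `h` and every `N` with `D^[N] h = 0`,
    `φ h = ∑_{i<N} D^i(h)/i!`.  (For a locally nilpotent `D` this characterizes
    the exponential automorphism.) -/
def IsExpOf {σ : Type*} (D : MvPolynomial σ k → MvPolynomial σ k)
    (φ : MvPolynomial σ k ≃ₐ[k] MvPolynomial σ k) : Prop :=
  ∀ (h : MvPolynomial σ k) (N : ℕ), D^[N] h = 0 →
    φ h = ∑ i ∈ Finset.range N, (Nat.factorial i : k)⁻¹ • D^[i] h

/-- `α` is an affine automorphism: `α(x_i) = ∑_j a_{j,i} x_j + b_i` with `A ∈ GL₃(k)`. -/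
def IsAffine (α : MvPolynomial (Fin 3) k ≃ₐ[k] MvPolynomial (Fin 3) k) : Prop :=
  ∃ (A : Matrix (Fin 3) (Fin 3) k) (b : Fin 3 → k), IsUnit A.det ∧
    ∀ i : Fin 3, α (X i) = (∑ j : Fin 3, C (A j i) * X j) + C (b i)

/-- `Aff_3(k)` as a set of automorphisms. -/
def AffSet : Set (MvPolynomial (Fin 3) k ≃ₐ[k] MvPolynomial (Fin 3) k) := {α | IsAffine α}

/-- `α` is a triangular automorphism: `α(x_i) = a_i x_i + f_i(x_1,…,x_{i-1})`, `a_i ≠ 0`. -/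
def IsTriangular (α : MvPolynomial (Fin 3) k ≃ₐ[k] MvPolynomial (Fin 3) k) : Prop :=
  ∃ (a : Fin 3 → k) (p : Fin 3 → MvPolynomial (Fin 3) k),
    (∀ i, a i ≠ 0) ∧ (∀ i, p i ∈ MvPolynomial.supported k {j | j < i}) ∧
    (∀ i, α (X i) = C (a i) * X i + p i)

/-- `BA_3(k)` as a set of automorphisms. -/
def TriSet : Set (MvPolynomial (Fin 3) k ≃ₐ[k] MvPolynomial (Fin 3) k) := {α | IsTriangular α}

/-- The tame subgroup `TA_3(k) = ⟨Aff_3(k), BA_3(k)⟩`. -/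
def TA : Subgroup (MvPolynomial (Fin 3) k ≃ₐ[k] MvPolynomial (Fin 3) k) :=
  Subgroup.closure (AffSet ∪ TriSet)

/-- `β = β_u = (u^3 x1, u^2 x2, u x3)`. -/
def IsBeta (u : k) (β : MvPolynomial (Fin 3) k ≃ₐ[k] MvPolynomial (Fin 3) k) : Prop :=
  β (X 0) = C (u ^ 3) * X 0 ∧ β (X 1) = C (u ^ 2) * X 1 ∧ β (X 2) = C u * X 2

/-- `B = {β_u | u ∈ k^*}`. -/
def BSet : Set (MvPolynomial (Fin 3) k ≃ₐ[k] MvPolynomial (Fin 3) k) :=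
  {β | ∃ u : k, u ≠ 0 ∧ IsBeta u β}

/-! Six-variable ring `k[x1,x2,x3,t_r,t_f,t_g]`:
variables `X 0 = x1, X 1 = x2, X 2 = x3, X 3 = t_r, X 4 = t_f, X 5 = t_g`. -/

/-- The inclusion of variable index sets. -/
def ι36 : Fin 3 → Fin 6 := Fin.castLE (by norm_num)

/-- The embedding `k[x1,x2,x3] → k[x1,x2,x3,t_r,t_f,t_g]`. -/
def embP : MvPolynomial (Fin 3) k →ₐ[k] MvPolynomial (Fin 6) k := rename ι36

/-- The substitution map `π : t_r ↦ r, t_f ↦ f, t_g ↦ g` (fixing `x1,x2,x3`). -/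
def piMap : MvPolynomial (Fin 6) k →ₐ[k] MvPolynomial (Fin 3) k :=
  aeval ![X 0, X 1, X 2, rP, fP, gP]

/-- The triangular derivation
`Δ' = -2 t_r t_f ∂/∂x1 + (4 x1 t_r - t_g) ∂/∂x2 + (6 x2 t_r + 2 t_f²) ∂/∂x3 - t_f t_g ∂/∂t_r`. -/
def Del' (p : MvPolynomial (Fin 6) k) : MvPolynomial (Fin 6) k :=
  (-(2 * X 3 * X 4)) * pderiv 0 p + (4 * X 0 * X 3 - X 5) * pderiv 1 p +
  (6 * X 1 * X 3 + 2 * X 4 ^ 2) * pderiv 2 p + (-(X 4 * X 5)) * pderiv 3 p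

/-- The weight `w1 = (1,2,3,1,0,1)`. -/
def w1 : Fin 6 → ℕ := ![1, 2, 3, 1, 0, 1]

/-- The weight `w2 = (0,0,0,0,1,0)`. -/
def w2 : Fin 6 → ℕ := ![0, 0, 0, 0, 1, 0]

/-- The sixth cyclic lexicographic order on exponent vectors: first compare the
exponent of `t_g`, then lexicographically the exponents of `x1,x2,x3,t_r,t_f`. -/
def cyclicLt (a b : Fin 6 →₀ ℕ) : Prop :=
  a 5 < b 5 ∨ (a 5 = b 5 ∧ ∃ m : Fin 5,
    (∀ l : Fin 5, l < m → a l.castSucc = b l.castSucc) ∧ a m.castSucc < b m.castSucc)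

/-- The leading monomial of `p` (for the sixth cyclic lexicographic order) is `m`. -/
def LeadMonIs (p : MvPolynomial (Fin 6) k) (m : Fin 6 →₀ ℕ) : Prop :=
  m ∈ p.support ∧ ∀ m' ∈ p.support, m' ≠ m → cyclicLt m' m

/-- The exponent vector of the monomial `t_f^δ t_g^γ`. -/
def tfMon (γ δ : ℕ) : Fin 6 →₀ ℕ := Finsupp.single 4 δ + Finsupp.single 5 γ

/-- The set `P_{γ,δ}`. -/
def Pset (γ δ : ℕ) : Set (MvPolynomial (Fin 6) k) :=
  {p | p ≠ 0 ∧ weightedTotalDegree w1 p ≤ γ ∧ weightedTotalDegree w2 p ≤ δ ∧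
    LeadMonIs p (tfMon γ δ)}

/-- `α'` is a lift of `α`. -/
def IsLift (α : MvPolynomial (Fin 3) k ≃ₐ[k] MvPolynomial (Fin 3) k)
    (α' : MvPolynomial (Fin 6) k →ₐ[k] MvPolynomial (Fin 6) k) : Prop :=
  (∀ i : Fin 3, α' (X (ι36 i)) = embP (α (X i))) ∧
  (∀ p, piMap (α' p) = α (piMap p))

/-- `t = γ_j = max {i | a_{i,j} ≠ 0}` (with rows indexed `1,2,3`). -/
def TypeIs (A : Matrix (Fin 3) (Fin 3) k) (j : Fin 3) (t : ℕ) : Prop :=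
  ∃ i : Fin 3, t = (i : ℕ) + 1 ∧ A i j ≠ 0 ∧ ∀ i' : Fin 3, i < i' → A i' j = 0

/-- Condition (C) for a lift `α'` of an affine automorphism of type `(γ1,γ2,γ3)`,
relative to `φ' = exp(uΔ')`. -/
def CondC (γ1 γ2 γ3 : ℕ) (φ' : MvPolynomial (Fin 6) k ≃ₐ[k] MvPolynomial (Fin 6) k)
    (α' : MvPolynomial (Fin 6) k →ₐ[k] MvPolynomial (Fin 6) k) : Prop :=
  ∃ m4 m5 m6 n4 n5 n6 : ℕ,
    1 ≤ n4 ∧ 1 ≤ n5 ∧ 1 ≤ n6 ∧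
    φ' (α' (X 3)) ∈ Pset m4 n4 ∧
    φ' (α' (X 4)) ∈ Pset m5 n5 ∧
    φ' (α' (X 5)) ∈ Pset m6 n6 ∧
    γ1 ≤ m6 ∧ γ2 ≤ 2 * m6 ∧ γ3 ≤ 3 * m6 ∧ m4 ≤ m6 ∧
    γ1 + 1 ≤ n6 - 1 ∧ γ2 + 1 ≤ 2 * (n6 - 1) ∧ γ3 + 1 ≤ 3 * (n6 - 1) ∧ n4 ≤ n6 - 1

/-- The image of `x_j` under the affine map given by `(A, d)`, inside the six-variable ring. -/
def affImg (A : Matrix (Fin 3) (Fin 3) k) (d : Fin 3 → k) (j : Fin 3) :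
    MvPolynomial (Fin 6) k :=
  (∑ i : Fin 3, C (A i j) * X (ι36 i)) + C (d j)

/-- The image of `t_f` under the lift `α̂`:
`α̂(t_f) = α(f) + (a_{1,1}a_{3,3} - 2a_{1,2}a_{3,2} + a_{1,3}a_{3,1})(t_f - f)`. -/
def hatTf (A : Matrix (Fin 3) (Fin 3) k) (d : Fin 3 → k) : MvPolynomial (Fin 6) k :=
  (affImg A d 0 * affImg A d 2 - affImg A d 1 ^ 2) +
    C (A 0 0 * A 2 2 - 2 * (A 0 1 * A 2 1) + A 0 2 * A 2 0) *
      (X 4 - (X 0 * X 2 - X 1 ^ 2))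

/-- The lift `α̂` of the affine automorphism given by `(A, d)`:
`α̂(x_i) = α(x_i)`, `α̂(t_f)` as in `hatTf`, `α̂(t_r) = α̂(x2 t_f + x1²)`,
`α̂(t_g) = α̂(x3 t_f² + 2 x1 x2 t_f + x1³)`. -/
def hatLift (A : Matrix (Fin 3) (Fin 3) k) (d : Fin 3 → k) :
    MvPolynomial (Fin 6) k →ₐ[k] MvPolynomial (Fin 6) k :=
  aeval ![affImg A d 0, affImg A d 1, affImg A d 2,
    affImg A d 1 * hatTf A d + affImg A d 0 ^ 2,
    hatTf A d,
    affImg A d 2 * hatTf A d ^ 2 + 2 * affImg A d 0 * affImg A d 1 * hatTf A d +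
      affImg A d 0 ^ 3]

/-- Monomials in `x1, x2, x3, r, f, g` of `w1`-weight at most `m` and `f`-exponent at most `n`,
other than `f^n g^m`. -/
def lowMonomials (m n : ℕ) : Set (MvPolynomial (Fin 3) k) :=
  {h | ∃ a b c d e l : ℕ, a + 2 * b + 3 * c + d + l ≤ m ∧ e ≤ n ∧ (l < m ∨ e < n) ∧
    h = X 0 ^ a * X 1 ^ b * X 2 ^ c * rP ^ d * fP ^ e * gP ^ l}

/-- The span of `lowMonomials m n`. -/
def lowSpan (m n : ℕ) : Submodule k (MvPolynomial (Fin 3) k) :=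
  Submodule.span k (lowMonomials m n)

/-- `h` is congruent to `c f^n g^m` modulo `lowSpan m n`. -/
def HasLead (m n : ℕ) (c : k) (h : MvPolynomial (Fin 3) k) : Prop :=
  ∃ w ∈ lowSpan m n, h = C c * (fP ^ n * gP ^ m) + w

theorem mem_lowSpan {m n : ℕ} (a b c d e l : ℕ) (h1 : a + 2 * b + 3 * c + d + l ≤ m)
    (h2 : e ≤ n) (h3 : l < m ∨ e < n) :
    (X 0 ^ a * X 1 ^ b * X 2 ^ c * rP ^ d * fP ^ e * gP ^ l : MvPolynomial (Fin 3) k) ∈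
      lowSpan m n :=
  Submodule.subset_span ⟨a, b, c, d, e, l, h1, h2, h3, rfl⟩

theorem lowSpan_mono {m n M N : ℕ} (hm : m ≤ M) (hn : n ≤ N) :
    lowSpan (k := k) m n ≤ lowSpan M N := by
  refine Submodule.span_le.2 ?_
  rintro _ ⟨a, b, c, d, e, l, h1, h2, h3, rfl⟩
  exact mem_lowSpan a b c d e l (by omega) (by omega) (by omega)

theorem lead_mem_lowSpan {m n M N : ℕ} (hm : m ≤ M) (hn : n ≤ N) (h : m < M ∨ n < N) :
    (fP ^ n * gP ^ m : MvPolynomial (Fin 3) k) ∈ lowSpan M N := by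
  simpa using mem_lowSpan (k := k) 0 0 0 0 n m (by omega) hn h

theorem mul_mem_lowSpan {m n m' n' : ℕ} {p q : MvPolynomial (Fin 3) k}
    (hp : p ∈ lowSpan m n) (hq : q ∈ lowSpan m' n') : p * q ∈ lowSpan (m + m') (n + n') := by
  have h := Submodule.mul_mem_mul hp hq
  rw [lowSpan, lowSpan, Submodule.span_mul_span] at h
  refine Submodule.span_mono ?_ h
  rintro _ ⟨_, ⟨a, b, c, d, e, l, h1, h2, h3, rfl⟩, _, ⟨a', b', c', d', e', l', h1', h2', h3', rfl⟩,
    rfl⟩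
  exact ⟨a + a', b + b', c + c', d + d', e + e', l + l', by omega, by omega, by omega, by ring⟩

theorem lead_mul_mem_lowSpan {m n m' n' : ℕ} {q : MvPolynomial (Fin 3) k}
    (hq : q ∈ lowSpan m' n') : fP ^ n * gP ^ m * q ∈ lowSpan (m + m') (n + n') := by
  induction hq using Submodule.span_induction with
  | mem x hx =>
    obtain ⟨a, b, c, d, e, l, h1, h2, h3, rfl⟩ := hx
    convert mem_lowSpan (k := k) (m := m + m') (n := n + n') a b c d (n + e) (m + l)
      (by omega) (by omega) (by omega) using 1
    ring
  | zero => simp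
  | add x y _ _ hx hy => rw [mul_add]; exact add_mem hx hy
  | smul t x _ hx => rw [mul_smul_comm]; exact Submodule.smul_mem _ _ hx

theorem C_mul_mem_lowSpan {m n : ℕ} {q : MvPolynomial (Fin 3) k} (c : k)
    (hq : q ∈ lowSpan m n) : C c * q ∈ lowSpan m n := by
  rw [← smul_eq_C_mul]; exact Submodule.smul_mem _ _ hq

namespace HasLead

variable {m n m' n' : ℕ} {c c' : k} {h h' : MvPolynomial (Fin 3) k}

theorem of_mem (hw : h ∈ lowSpan m n) : HasLead m n 0 h := ⟨h, hw, by simp⟩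

theorem congr (H : HasLead m n c h) (hm : m = m') (hn : n = n') (hc : c = c') (hh : h = h') :
    HasLead m' n' c' h' := by
  subst hm hn hc hh; exact H

theorem add (H : HasLead m n c h) (H' : HasLead m n c' h') : HasLead m n (c + c') (h + h') := by
  obtain ⟨w, hw, rfl⟩ := H
  obtain ⟨w', hw', rfl⟩ := H'
  exact ⟨w + w', add_mem hw hw', by rw [C_add]; ring⟩

theorem const_mul (t : k) (H : HasLead m n c h) : HasLead m n (t * c) (C t * h) := by
  obtain ⟨w, hw, rfl⟩ := H
  exact ⟨C t * w, C_mul_mem_lowSpan t hw, by rw [C_mul]; ring⟩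

theorem weaken (H : HasLead m n c h) (hm : m ≤ m') (hn : n ≤ n') (hlt : m < m' ∨ n < n') :
    HasLead m' n' 0 h := by
  obtain ⟨w, hw, rfl⟩ := H
  exact of_mem (add_mem (C_mul_mem_lowSpan c (lead_mem_lowSpan hm hn hlt))
    (lowSpan_mono hm hn hw))

theorem mul (H : HasLead m n c h) (H' : HasLead m' n' c' h') :
    HasLead (m + m') (n + n') (c * c') (h * h') := by
  obtain ⟨w, hw, rfl⟩ := H
  obtain ⟨w', hw', rfl⟩ := H'
  refine ⟨C c * (fP ^ n * gP ^ m * w') + C c' * (fP ^ n' * gP ^ m' * w) + w * w', ?_, ?_⟩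
  · refine add_mem (add_mem (C_mul_mem_lowSpan _ (lead_mul_mem_lowSpan hw'))
      (C_mul_mem_lowSpan _ ?_)) (mul_mem_lowSpan hw hw')
    have := lead_mul_mem_lowSpan (m := m') (n := n') hw
    rwa [add_comm m', add_comm n'] at this
  · rw [C_mul]; ring

theorem one : HasLead 0 0 1 (1 : MvPolynomial (Fin 3) k) := ⟨0, zero_mem _, by simp⟩

theorem const (t : k) : HasLead 0 0 t (C t) := ⟨0, zero_mem _, by simp⟩

theorem pow (H : HasLead m n c h) (j : ℕ) : HasLead (j * m) (j * n) (c ^ j) (h ^ j) := by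
  induction j with
  | zero => exact one.congr (by simp) (by simp) (by simp) (by simp)
  | succ j ih => exact (ih.mul H).congr (by ring) (by ring) (by ring) (by ring)

theorem f : HasLead 0 1 1 (fP : MvPolynomial (Fin 3) k) := ⟨0, zero_mem _, by simp⟩

theorem g : HasLead 1 0 1 (gP : MvPolynomial (Fin 3) k) := ⟨0, zero_mem _, by simp⟩

theorem r : HasLead 1 0 0 (rP : MvPolynomial (Fin 3) k) :=
  of_mem (by simpa using mem_lowSpan (k := k) (m := 1) (n := 0) 0 0 0 1 0 0)

theorem x1 : HasLead 1 0 0 (X 0 : MvPolynomial (Fin 3) k) :=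
  of_mem (by simpa using mem_lowSpan (k := k) (m := 1) (n := 0) 1 0 0 0 0 0)

theorem x2 : HasLead 2 0 0 (X 1 : MvPolynomial (Fin 3) k) :=
  of_mem (by simpa using mem_lowSpan (k := k) (m := 2) (n := 0) 0 1 0 0 0 0)

theorem x3 : HasLead 3 0 0 (X 2 : MvPolynomial (Fin 3) k) :=
  of_mem (by simpa using mem_lowSpan (k := k) (m := 3) (n := 0) 0 0 1 0 0 0)

/-- Transport of leading terms under a homomorphism with controlled degrees on generators. -/
theorem map (ψ : MvPolynomial (Fin 3) k →ₐ[k] MvPolynomial (Fin 3) k)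
    {p1 p2 p3 p4 p5 p6 q1 q2 q3 q4 q5 q6 : ℕ} {c1 c2 c3 c4 c5 c6 : k}
    (H1 : HasLead p1 q1 c1 (ψ (X 0))) (H2 : HasLead p2 q2 c2 (ψ (X 1)))
    (H3 : HasLead p3 q3 c3 (ψ (X 2))) (H4 : HasLead p4 q4 c4 (ψ rP))
    (H5 : HasLead p5 q5 c5 (ψ fP)) (H6 : HasLead p6 q6 c6 (ψ gP))
    (hp1 : p1 ≤ p6) (hp2 : p2 ≤ 2 * p6) (hp3 : p3 ≤ 3 * p6) (hp4 : p4 ≤ p6)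
    (hq1 : q1 + 1 ≤ q6) (hq2 : q2 + 2 ≤ 2 * q6) (hq3 : q3 + 3 ≤ 3 * q6) (hq4 : q4 + 1 ≤ q6)
    (hq5 : 1 ≤ q5) (H : HasLead m n c h) :
    HasLead (p5 * n + p6 * m) (q5 * n + q6 * m) (c * (c5 ^ n * c6 ^ m)) (ψ h) := by
  obtain ⟨w, hw, rfl⟩ := H
  have hlow : HasLead (p5 * n + p6 * m) (q5 * n + q6 * m) 0 (ψ w) := by
    induction hw using Submodule.span_induction with
    | mem x hx =>
      obtain ⟨a, b, c, d, e, l, h1, h2, h3, rfl⟩ := hx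
      simp only [map_mul, map_pow]
      refine (((((((H1.pow a).mul (H2.pow b)).mul (H3.pow c)).mul (H4.pow d)).mul
        (H5.pow e)).mul (H6.pow l))).weaken ?_ ?_ ?_
      · have e1 := Nat.mul_le_mul_left a hp1
        have e2 := Nat.mul_le_mul_left b hp2
        have e3 := Nat.mul_le_mul_left c hp3
        have e4 := Nat.mul_le_mul_left d hp4
        have e5 := Nat.mul_le_mul_left p5 h2
        have e6 := Nat.mul_le_mul_left p6 h1
        nlinarith
      · have e1 := Nat.mul_le_mul_left a hq1
        have e2 := Nat.mul_le_mul_left b hq2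
        have e3 := Nat.mul_le_mul_left c hq3
        have e4 := Nat.mul_le_mul_left d hq4
        have e5 := Nat.mul_le_mul_left q5 h2
        have e6 := Nat.mul_le_mul_left q6 h1
        nlinarith
      · right
        have e1 := Nat.mul_le_mul_left a hq1
        have e2 := Nat.mul_le_mul_left b hq2
        have e3 := Nat.mul_le_mul_left c hq3
        have e4 := Nat.mul_le_mul_left d hq4
        have e5 := Nat.mul_le_mul_left q5 h2
        have e6 := Nat.mul_le_mul_left q6 h1
        rcases Nat.eq_zero_or_pos (a + 2 * b + 3 * c + d) with h0 | h0
        · obtain ⟨rfl, rfl, rfl, rfl⟩ : a = 0 ∧ b = 0 ∧ c = 0 ∧ d = 0 := by omega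
          rcases h3 with h3 | h3
          · have := Nat.mul_le_mul_left q6 (Nat.succ_le_of_lt h3)
            simp only [Nat.succ_eq_add_one, mul_add] at this
            nlinarith
          · have := Nat.mul_le_mul_left q5 (Nat.succ_le_of_lt h3)
            simp only [Nat.succ_eq_add_one, mul_add] at this
            nlinarith
        · nlinarith
    | zero => simpa using of_mem (zero_mem _)
    | add x y _ _ hx hy => rw [map_add]; simpa using hx.add hy
    | smul t x _ hx => rw [map_smul, smul_eq_C_mul]; simpa using hx.const_mul t
  have hmain := (((H5.pow n).mul (H6.pow m)).const_mul c)
  refine ((hmain.congr (by ring) (by ring) rfl rfl).add hlow).congr rfl rfl (by ring) ?_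
  simp [algHom_C]

end HasLead

theorem natDegree_aeval_of_mem_lowSpan {m n : ℕ} (hn : 1 ≤ n) {w : MvPolynomial (Fin 3) k}
    (hw : w ∈ lowSpan m n) :
    (aeval ![Polynomial.X, 0, Polynomial.X] w : Polynomial k).natDegree < 5 * m + 2 * n := by
  induction hw using Submodule.span_induction with
  | mem x hx =>
    obtain ⟨a, b, c, d, e, l, h1, h2, h3, rfl⟩ := hx
    have hf : (aeval ![Polynomial.X, 0, Polynomial.X] (fP : MvPolynomial (Fin 3) k) :
        Polynomial k) = Polynomial.X ^ 2 := by simp [fP]; ring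
    have hr : (aeval ![Polynomial.X, 0, Polynomial.X] (rP : MvPolynomial (Fin 3) k) :
        Polynomial k) = Polynomial.X ^ 2 := by simp [rP]
    have hg : (aeval ![Polynomial.X, 0, Polynomial.X] (gP : MvPolynomial (Fin 3) k) :
        Polynomial k) = Polynomial.X ^ 5 + Polynomial.X ^ 3 := by simp [gP, hf]; ring
    simp only [map_mul, map_pow, hf, hr, hg, aeval_X]
    have hdeg : (Polynomial.X ^ 5 + Polynomial.X ^ 3 : Polynomial k).natDegree ≤ 5 := by
      compute_degree
    have hl : ((Polynomial.X ^ 5 + Polynomial.X ^ 3 : Polynomial k) ^ l).natDegree ≤ l * 5 :=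
      Polynomial.natDegree_pow_le_of_le l hdeg
    rcases Nat.eq_zero_or_pos b with rfl | hb
    · have key := Polynomial.natDegree_mul_le_of_le (p := (Polynomial.X : Polynomial k) ^
        (a + c + 2 * d + 2 * e)) (Polynomial.natDegree_X_pow_le _) hl
      refine lt_of_le_of_lt (le_trans (le_of_eq ?_) key) (by omega)
      congr 2
      simp
      ring
    · simp [hb.ne']; omega
  | zero => simp; omega
  | add x y _ _ hx hy =>
    rw [map_add]
    exact lt_of_le_of_lt (Polynomial.natDegree_add_le _ _) (max_lt hx hy)
  | smul t x _ hx =>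
    rw [map_smul]
    exact lt_of_le_of_lt (Polynomial.natDegree_smul_le _ _) hx

theorem HasLead.natDegree_aeval {m n : ℕ} {c : k} {h : MvPolynomial (Fin 3) k}
    (H : HasLead m n c h) (hc : c ≠ 0) (hn : 1 ≤ n) :
    (aeval ![Polynomial.X, 0, Polynomial.X] h : Polynomial k).natDegree = 5 * m + 2 * n := by
  obtain ⟨w, hw, rfl⟩ := H
  have hw' := natDegree_aeval_of_mem_lowSpan hn hw
  have hf : (aeval ![Polynomial.X, 0, Polynomial.X] (fP : MvPolynomial (Fin 3) k) :
      Polynomial k) = Polynomial.X ^ 2 := by simp [fP]; ring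
  have hg : (aeval ![Polynomial.X, 0, Polynomial.X] (gP : MvPolynomial (Fin 3) k) :
      Polynomial k) = Polynomial.X ^ 5 + Polynomial.X ^ 3 := by simp [gP, hf]; ring
  have hm : (Polynomial.X ^ 5 + Polynomial.X ^ 3 : Polynomial k).Monic := by monicity!
  have hd : (Polynomial.X ^ 5 + Polynomial.X ^ 3 : Polynomial k).natDegree = 5 := by
    compute_degree!
  have hlead : (aeval ![Polynomial.X, 0, Polynomial.X] (C c * (fP ^ n * gP ^ m)) :
      Polynomial k).natDegree = 5 * m + 2 * n := by
    simp only [map_mul, map_pow, hf, hg]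
    rw [algHom_C, Polynomial.algebraMap_eq, Polynomial.natDegree_C_mul hc, ← pow_mul,
      Polynomial.Monic.natDegree_mul (Polynomial.monic_X_pow _) (hm.pow m),
      hm.natDegree_pow, hd, Polynomial.natDegree_X_pow]
    ring
  rw [map_add, Polynomial.natDegree_add_eq_left_of_natDegree_lt (by omega), hlead]

/-- An affine automorphism does not decrease the degree below that of a polynomial with given
leading term. -/
theorem HasLead.le_totalDegree {m n : ℕ} {c : k} {h : MvPolynomial (Fin 3) k}
    (H : HasLead m n c h) (hc : c ≠ 0) (hn : 1 ≤ n)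
    {α : MvPolynomial (Fin 3) k ≃ₐ[k] MvPolynomial (Fin 3) k} (hα : IsAffine α) :
    5 * m + 2 * n ≤ (α h).totalDegree := by
  obtain ⟨A, b, hA, hAb⟩ := hα
  have hinv : ∀ j, α.symm (X j) = (∑ i, C (A⁻¹ i j) * X i) - C (∑ i, A⁻¹ i j * b i) := by
    intro j
    rw [AlgEquiv.symm_apply_eq]
    simp only [map_sub, map_sum, map_mul, hAb, ← algebraMap_eq, AlgEquiv.commutes]
    have hinvA : ∀ l, ∑ i, A l i * A⁻¹ i j = if l = j then 1 else 0 := by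
      intro l
      rw [← Matrix.mul_apply, Matrix.mul_nonsing_inv _ hA, Matrix.one_apply]
    have e : (X j : MvPolynomial (Fin 3) k) = ∑ l, C (∑ i, A l i * A⁻¹ i j) * X l := by
      simp [hinvA]
    rw [e]
    simp only [Fin.sum_univ_three, algebraMap_eq, C_add, C_mul]
    ring
  rw [← H.natDegree_aeval hc hn]
  let ev : MvPolynomial (Fin 3) k →ₐ[k] Polynomial k := aeval ![Polynomial.X, 0, Polynomial.X]
  have hev : ev.comp (α.symm : _ →ₐ[k] _) = aeval fun j => ev (α.symm (X j)) := by
    ext j; simp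
  have h1 : ev h = aeval (fun j => ev (α.symm (X j))) (α h) := by
    rw [← hev]; simp
  change (ev h).natDegree ≤ _
  rw [h1, ← mul_one (α h).totalDegree]
  refine MvPolynomial.aeval_natDegree_le _ le_rfl _ fun j => ?_
  rw [hinv]
  simp only [Fin.sum_univ_three, map_sub, map_add, map_mul, algHom_C, ev, aeval_X,
    Polynomial.algebraMap_eq]
  simp only [Matrix.cons_val]
  compute_degree
/-- `Del` as a bundled derivation. -/
def delDerivation : Derivation k (MvPolynomial (Fin 3) k) (MvPolynomial (Fin 3) k) :=
  (pderiv 1 fP * pderiv 2 gP - pderiv 2 fP * pderiv 1 gP : MvPolynomial (Fin 3) k) • pderiv 0 +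
  (pderiv 2 fP * pderiv 0 gP - pderiv 0 fP * pderiv 2 gP : MvPolynomial (Fin 3) k) • pderiv 1 +
  (pderiv 0 fP * pderiv 1 gP - pderiv 1 fP * pderiv 0 gP : MvPolynomial (Fin 3) k) • pderiv 2

theorem Del_eq_delDerivation (h : MvPolynomial (Fin 3) k) : Del h = delDerivation h := by
  simp only [Del, Matrix.det_fin_three, delDerivation, Derivation.add_apply,
    Derivation.smul_apply, smul_eq_mul, Matrix.of_apply, Matrix.cons_val]
  ring

theorem delDerivation_f : delDerivation (fP : MvPolynomial (Fin 3) k) = 0 := by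
  simp only [delDerivation, Derivation.add_apply, Derivation.smul_apply, smul_eq_mul]
  ring

theorem delDerivation_g : delDerivation (gP : MvPolynomial (Fin 3) k) = 0 := by
  simp only [delDerivation, Derivation.add_apply, Derivation.smul_apply, smul_eq_mul]
  ring

theorem pderiv_f : pderiv 0 (fP : MvPolynomial (Fin 3) k) = X 2 ∧
    pderiv 1 (fP : MvPolynomial (Fin 3) k) = -(2 * X 1) ∧
    pderiv 2 (fP : MvPolynomial (Fin 3) k) = X 0 := by
  refine ⟨?_, ?_, ?_⟩ <;>
    simp [fP, pderiv_X, Derivation.leibniz, Derivation.leibniz_pow]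

theorem pderiv_g :
    pderiv 0 (gP : MvPolynomial (Fin 3) k) =
      2 * X 2 ^ 2 * fP + 2 * X 1 * fP + 2 * X 0 * X 1 * X 2 + 3 * X 0 ^ 2 ∧
    pderiv 1 (gP : MvPolynomial (Fin 3) k) =
      -(4 * X 1 * X 2 * fP) + 2 * X 0 * fP - 4 * X 0 * X 1 ^ 2 ∧
    pderiv 2 (gP : MvPolynomial (Fin 3) k) =
      fP ^ 2 + 2 * X 0 * X 2 * fP + 2 * X 0 ^ 2 * X 1 := by
  obtain ⟨h0, h1, h2⟩ := pderiv_f (k := k)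
  have two : ∀ i, pderiv i (2 : MvPolynomial (Fin 3) k) = 0 := fun i => by
    simpa using (pderiv i).map_natCast (R := k) (A := MvPolynomial (Fin 3) k) 2
  refine ⟨?_, ?_, ?_⟩ <;>
  · simp [gP, pderiv_X, Derivation.leibniz, Derivation.leibniz_pow, h0, h1, h2,
      two]
    ring

theorem delDerivation_x1 :
    delDerivation (X 0 : MvPolynomial (Fin 3) k) = -(2 * rP * fP) := by
  obtain ⟨h0, h1, h2⟩ := pderiv_f (k := k)
  obtain ⟨g0, g1, g2⟩ := pderiv_g (k := k)
  simp [delDerivation, pderiv_X, h0, h1, h2, g0, g1, g2]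
  simp only [rP, fP]
  ring

theorem delDerivation_x2 :
    delDerivation (X 1 : MvPolynomial (Fin 3) k) = 4 * X 0 * rP - gP := by
  obtain ⟨h0, h1, h2⟩ := pderiv_f (k := k)
  obtain ⟨g0, g1, g2⟩ := pderiv_g (k := k)
  simp [delDerivation, pderiv_X, h0, h1, h2, g0, g1, g2]
  simp only [gP, rP, fP]
  ring

theorem delDerivation_x3 :
    delDerivation (X 2 : MvPolynomial (Fin 3) k) = 6 * X 1 * rP + 2 * fP ^ 2 := by
  obtain ⟨h0, h1, h2⟩ := pderiv_f (k := k)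
  obtain ⟨g0, g1, g2⟩ := pderiv_g (k := k)
  simp [delDerivation, pderiv_X, h0, h1, h2, g0, g1, g2]
  simp only [rP, fP]
  ring

theorem delDerivation_r :
    delDerivation (rP : MvPolynomial (Fin 3) k) = -(fP * gP) := by
  have h : delDerivation (rP : MvPolynomial (Fin 3) k) =
      fP * delDerivation (X 1) + 2 * X 0 * delDerivation (X 0) := by
    simp [rP, Derivation.leibniz, Derivation.leibniz_pow, delDerivation_f]
    ring
  rw [h, delDerivation_x1, delDerivation_x2]
  ring

section Exponential

variable {u : k} {φ : MvPolynomial (Fin 3) k ≃ₐ[k] MvPolynomial (Fin 3) k}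

theorem IsExpOf.apply_eq_sum [CharZero k] (hφ : IsExpOf (fun h => u • Del h) φ)
    (e : ℕ → MvPolynomial (Fin 3) k)
    (he : ∀ i, C u * delDerivation (e i) = ((i + 1 : ℕ) : MvPolynomial (Fin 3) k) * e (i + 1))
    (N : ℕ) (hN : e N = 0) :
    φ (e 0) = ∑ i ∈ Finset.range N, e i := by
  have hit : ∀ i, (fun h : MvPolynomial (Fin 3) k => u • Del h)^[i] (e 0) =
      (Nat.factorial i : k) • e i := by
    intro i
    induction i with
    | zero => simp
    | succ i ih =>
      rw [Function.iterate_succ_apply', ih]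
      simp only [Del_eq_delDerivation, Derivation.map_smul]
      rw [smul_comm, smul_eq_C_mul (delDerivation (e i)), he, Nat.factorial_succ]
      simp only [smul_eq_C_mul, Nat.cast_mul, map_natCast, C_mul]
      ring
  rw [hφ (e 0) N (by rw [hit, hN, smul_zero])]
  refine Finset.sum_congr rfl fun i _ => ?_
  rw [hit, smul_smul, inv_mul_cancel₀ (Nat.cast_ne_zero.2 i.factorial_ne_zero), one_smul]

theorem IsExpOf.apply_f (hφ : IsExpOf (fun h => u • Del h) φ) : φ fP = fP := by
  have := hφ fP 1 (by simp [Del_eq_delDerivation, delDerivation_f])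
  simpa using this

theorem IsExpOf.apply_g (hφ : IsExpOf (fun h => u • Del h) φ) : φ gP = gP := by
  have := hφ gP 1 (by simp [Del_eq_delDerivation, delDerivation_g])
  simpa using this

theorem IsExpOf.apply_r [CharZero k] (hφ : IsExpOf (fun h => u • Del h) φ) :
    φ rP = rP - C u * (fP * gP) := by
  have := hφ.apply_eq_sum (fun i => [rP, -(C u * (fP * gP))].getD i 0) (fun i => by
    rcases i with _ | _ | i <;>
      simp [Derivation.leibniz, delDerivation_f, delDerivation_g, delDerivation_r]) 2 rfl
  simpa [Finset.sum_range_succ, sub_eq_add_neg] using this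

theorem delDerivation_ofNat (n : ℕ) [n.AtLeastTwo] :
    delDerivation (ofNat(n) : MvPolynomial (Fin 3) k) = 0 :=
  delDerivation.map_natCast n

theorem IsExpOf.apply_x1 [CharZero k] (hφ : IsExpOf (fun h => u • Del h) φ) :
    φ (X 0) = X 0 - C u * (2 * rP * fP) + C u ^ 2 * (fP ^ 2 * gP) := by
  have := hφ.apply_eq_sum (fun i => [X 0, -(C u * (2 * rP * fP)), C u ^ 2 * (fP ^ 2 * gP)].getD i 0)
    (fun i => by
      rcases i with _ | _ | _ | i <;>
      · simp [Derivation.leibniz, Derivation.leibniz_pow, delDerivation_f, delDerivation_g,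
          delDerivation_r, delDerivation_x1, delDerivation_ofNat]
        try ring) 3 rfl
  simpa [Finset.sum_range_succ, sub_eq_add_neg] using this

theorem IsExpOf.apply_x2 [CharZero k] (hφ : IsExpOf (fun h => u • Del h) φ) :
    φ (X 1) = X 1 + C u * (4 * X 0 * rP - gP) - C u ^ 2 * (4 * rP ^ 2 * fP + 2 * X 0 * fP * gP) +
      C u ^ 3 * (4 * rP * fP ^ 2 * gP) - C u ^ 4 * (fP ^ 3 * gP ^ 2) := by
  have := hφ.apply_eq_sum (fun i => [X 1, C u * (4 * X 0 * rP - gP),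
      -(C u ^ 2 * (4 * rP ^ 2 * fP + 2 * X 0 * fP * gP)), C u ^ 3 * (4 * rP * fP ^ 2 * gP),
      -(C u ^ 4 * (fP ^ 3 * gP ^ 2))].getD i 0)
    (fun i => by
      rcases i with _ | _ | _ | _ | _ | i <;>
      · simp [Derivation.leibniz, Derivation.leibniz_pow, delDerivation_f, delDerivation_g,
          delDerivation_r, delDerivation_x1, delDerivation_x2, delDerivation_ofNat]
        try ring) 5 rfl
  simpa [Finset.sum_range_succ, sub_eq_add_neg] using this

theorem IsExpOf.apply_x3 [CharZero k] (hφ : IsExpOf (fun h => u • Del h) φ) :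
    φ (X 2) = X 2 + C u * (6 * X 1 * rP + 2 * fP ^ 2) +
      C u ^ 2 * (12 * X 0 * rP ^ 2 - 3 * rP * gP - 3 * X 1 * fP * gP) +
      C u ^ 3 * (2 * fP * gP ^ 2 - 8 * rP ^ 3 * fP - 12 * X 0 * rP * fP * gP) +
      C u ^ 4 * (12 * rP ^ 2 * fP ^ 2 * gP + 3 * X 0 * fP ^ 2 * gP ^ 2) -
      C u ^ 5 * (6 * rP * fP ^ 3 * gP ^ 2) + C u ^ 6 * (fP ^ 4 * gP ^ 3) := by
  have := hφ.apply_eq_sum (fun i => [X 2, C u * (6 * X 1 * rP + 2 * fP ^ 2),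
      C u ^ 2 * (12 * X 0 * rP ^ 2 - 3 * rP * gP - 3 * X 1 * fP * gP),
      C u ^ 3 * (2 * fP * gP ^ 2 - 8 * rP ^ 3 * fP - 12 * X 0 * rP * fP * gP),
      C u ^ 4 * (12 * rP ^ 2 * fP ^ 2 * gP + 3 * X 0 * fP ^ 2 * gP ^ 2),
      -(C u ^ 5 * (6 * rP * fP ^ 3 * gP ^ 2)), C u ^ 6 * (fP ^ 4 * gP ^ 3)].getD i 0)
    (fun i => by
      rcases i with _ | _ | _ | _ | _ | _ | _ | i <;>
      · simp [Derivation.leibniz, Derivation.leibniz_pow, delDerivation_f, delDerivation_g,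
          delDerivation_r, delDerivation_x1, delDerivation_x2, delDerivation_x3,
          delDerivation_ofNat]
        try ring) 7 rfl
  simpa [Finset.sum_range_succ, sub_eq_add_neg] using this

theorem IsExpOf.apply_x3f_add_x1x2 [CharZero k] (hφ : IsExpOf (fun h => u • Del h) φ) :
    φ (X 2 * fP + X 0 * X 1) = X 2 * fP + X 0 * X 1 + C u * (4 * rP ^ 2 + 2 * fP ^ 3 - X 0 * gP) -
      C u ^ 2 * (3 * rP * fP * gP) + C u ^ 3 * (fP ^ 2 * gP ^ 2) := by
  have := hφ.apply_eq_sum (fun i => [X 2 * fP + X 0 * X 1,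
      C u * (4 * rP ^ 2 + 2 * fP ^ 3 - X 0 * gP),
      -(C u ^ 2 * (3 * rP * fP * gP)), C u ^ 3 * (fP ^ 2 * gP ^ 2)].getD i 0)
    (fun i => by
      rcases i with _ | _ | _ | _ | i
      · simp [Derivation.leibniz, Derivation.leibniz_pow, delDerivation_f, delDerivation_g,
          delDerivation_r, delDerivation_x1, delDerivation_x2, delDerivation_x3,
          delDerivation_ofNat]
        left
        rw [rP]
        ring
      all_goals
        simp [Derivation.leibniz, Derivation.leibniz_pow, delDerivation_f, delDerivation_g,
          delDerivation_r, delDerivation_x1, delDerivation_x2, delDerivation_x3,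
          delDerivation_ofNat]
        try ring) 4 rfl
  simpa [Finset.sum_range_succ, sub_eq_add_neg] using this

theorem C_mul_monomial_mem_lowSpan {m n : ℕ} (t : k) (a b c d e l : ℕ)
    (h : a + 2 * b + 3 * c + d + l ≤ m ∧ e ≤ n ∧ (l < m ∨ e < n)) :
    C t * (X 0 ^ a * X 1 ^ b * X 2 ^ c * rP ^ d * fP ^ e * gP ^ l) ∈ lowSpan m n :=
  C_mul_mem_lowSpan t (mem_lowSpan a b c d e l h.1 h.2.1 h.2.2)

theorem IsExpOf.hasLead_x1 [CharZero k] (hφ : IsExpOf (fun h => u • Del h) φ) :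
    HasLead 1 2 (u ^ 2) (φ (X 0)) := by
  rw [hφ.apply_x1]
  refine ⟨_, add_mem (C_mul_monomial_mem_lowSpan 1 1 0 0 0 0 0 (by omega))
    (C_mul_monomial_mem_lowSpan (-2 * u) 0 0 0 1 1 0 (by omega)), ?_⟩
  simp [map_ofNat]
  ring

theorem IsExpOf.hasLead_x2 [CharZero k] (hφ : IsExpOf (fun h => u • Del h) φ) :
    HasLead 2 3 (-u ^ 4) (φ (X 1)) := by
  rw [hφ.apply_x2]
  refine ⟨_, add_mem (add_mem (add_mem (add_mem (add_mem
    (C_mul_monomial_mem_lowSpan 1 0 1 0 0 0 0 (by omega))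
    (C_mul_monomial_mem_lowSpan (4 * u) 1 0 0 1 0 0 (by omega)))
    (C_mul_monomial_mem_lowSpan (-u) 0 0 0 0 0 1 (by omega)))
    (C_mul_monomial_mem_lowSpan (-4 * u ^ 2) 0 0 0 2 1 0 (by omega)))
    (C_mul_monomial_mem_lowSpan (-2 * u ^ 2) 1 0 0 0 1 1 (by omega)))
    (C_mul_monomial_mem_lowSpan (4 * u ^ 3) 0 0 0 1 2 1 (by omega)), ?_⟩
  simp [map_ofNat]
  ring

theorem IsExpOf.hasLead_x3 [CharZero k] (hφ : IsExpOf (fun h => u • Del h) φ) :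
    HasLead 3 4 (u ^ 6) (φ (X 2)) := by
  rw [hφ.apply_x3]
  refine ⟨_, add_mem (add_mem (add_mem (add_mem (add_mem (add_mem (add_mem (add_mem (add_mem
    (add_mem (add_mem
    (C_mul_monomial_mem_lowSpan 1 0 0 1 0 0 0 (by omega))
    (C_mul_monomial_mem_lowSpan (6 * u) 0 1 0 1 0 0 (by omega)))
    (C_mul_monomial_mem_lowSpan (2 * u) 0 0 0 0 2 0 (by omega)))
    (C_mul_monomial_mem_lowSpan (12 * u ^ 2) 1 0 0 2 0 0 (by omega)))
    (C_mul_monomial_mem_lowSpan (-3 * u ^ 2) 0 0 0 1 0 1 (by omega)))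
    (C_mul_monomial_mem_lowSpan (-3 * u ^ 2) 0 1 0 0 1 1 (by omega)))
    (C_mul_monomial_mem_lowSpan (2 * u ^ 3) 0 0 0 0 1 2 (by omega)))
    (C_mul_monomial_mem_lowSpan (-8 * u ^ 3) 0 0 0 3 1 0 (by omega)))
    (C_mul_monomial_mem_lowSpan (-12 * u ^ 3) 1 0 0 1 1 1 (by omega)))
    (C_mul_monomial_mem_lowSpan (12 * u ^ 4) 0 0 0 2 2 1 (by omega)))
    (C_mul_monomial_mem_lowSpan (3 * u ^ 4) 1 0 0 0 2 2 (by omega)))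
    (C_mul_monomial_mem_lowSpan (-6 * u ^ 5) 0 0 0 1 3 2 (by omega)), ?_⟩
  simp [map_ofNat]
  ring

theorem IsExpOf.hasLead_r [CharZero k] (hφ : IsExpOf (fun h => u • Del h) φ) :
    HasLead 1 1 (-u) (φ rP) := by
  rw [hφ.apply_r]
  refine ⟨_, C_mul_monomial_mem_lowSpan 1 0 0 0 1 0 0 (by omega), ?_⟩
  simp [map_ofNat]
  ring

theorem IsExpOf.hasLead_x3f_add_x1x2 [CharZero k] (hφ : IsExpOf (fun h => u • Del h) φ) :
    HasLead 3 4 0 (φ (X 2 * fP + X 0 * X 1)) := by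
  rw [hφ.apply_x3f_add_x1x2]
  refine ⟨_, add_mem (add_mem (add_mem (add_mem (add_mem (add_mem
    (C_mul_monomial_mem_lowSpan 1 0 0 1 0 1 0 (by omega))
    (C_mul_monomial_mem_lowSpan 1 1 1 0 0 0 0 (by omega)))
    (C_mul_monomial_mem_lowSpan (4 * u) 0 0 0 2 0 0 (by omega)))
    (C_mul_monomial_mem_lowSpan (2 * u) 0 0 0 0 3 0 (by omega)))
    (C_mul_monomial_mem_lowSpan (-u) 1 0 0 0 0 1 (by omega)))
    (C_mul_monomial_mem_lowSpan (-3 * u ^ 2) 0 0 0 1 1 1 (by omega)))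
    (C_mul_monomial_mem_lowSpan (u ^ 3) 0 0 0 0 2 2 (by omega)), ?_⟩
  simp [map_ofNat]
  ring

end Exponential

theorem HasLead.add_low {m n m' n' : ℕ} {c c' : k} {h h' : MvPolynomial (Fin 3) k}
    (H : HasLead m n c h) (H' : HasLead m' n' c' h')
    (hlt : m' ≤ m ∧ n' ≤ n ∧ (m' < m ∨ n' < n)) : HasLead m n c (h + h') :=
  (H.add (H'.weaken hlt.1 hlt.2.1 hlt.2.2)).congr rfl rfl (add_zero c) rfl

/-- `h` has a leading term `f^n g^m` with `m ≥ 1` and `n ≥ 2`. -/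
def HasGoodLead (h : MvPolynomial (Fin 3) k) : Prop :=
  ∃ (m n : ℕ) (c : k), 1 ≤ m ∧ 2 ≤ n ∧ c ≠ 0 ∧ HasLead m n c h

/-- The homomorphism `x_i ↦ L_i` preserves `HasGoodLead`. -/
def Admissible (L1 L2 L3 : MvPolynomial (Fin 3) k) : Prop :=
  ∀ ψ : MvPolynomial (Fin 3) k →ₐ[k] MvPolynomial (Fin 3) k,
    ψ (X 0) = L1 → ψ (X 1) = L2 → ψ (X 2) = L3 → ∀ h, HasGoodLead h → HasGoodLead (ψ h)

section Admissible

variable {L1 L2 L3 : MvPolynomial (Fin 3) k}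

theorem admissible_of_hasLead
    {p1 p2 p3 p4 p5 p6 q1 q2 q3 q4 q5 q6 : ℕ} {c1 c2 c3 c4 c5 c6 : k}
    (H1 : HasLead p1 q1 c1 L1) (H2 : HasLead p2 q2 c2 L2) (H3 : HasLead p3 q3 c3 L3)
    (H5 : HasLead p5 q5 c5 (L1 * L3 - L2 ^ 2))
    (H4 : HasLead p4 q4 c4 (L2 * (L1 * L3 - L2 ^ 2) + L1 ^ 2))
    (H6 : HasLead p6 q6 c6 (L3 * (L1 * L3 - L2 ^ 2) ^ 2 +
      2 * L1 * L2 * (L1 * L3 - L2 ^ 2) + L1 ^ 3))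
    (hp : p1 ≤ p6 ∧ p2 ≤ 2 * p6 ∧ p3 ≤ 3 * p6 ∧ p4 ≤ p6)
    (hq : q1 + 1 ≤ q6 ∧ q2 + 2 ≤ 2 * q6 ∧ q3 + 3 ≤ 3 * q6 ∧ q4 + 1 ≤ q6)
    (hpos : 1 ≤ q5 ∧ 1 ≤ p6 ∧ 2 ≤ q6) (h5 : c5 ≠ 0) (h6 : c6 ≠ 0) :
    Admissible L1 L2 L3 := by
  rintro ψ rfl rfl rfl h ⟨m, n, c, hm, hn, hc, H⟩
  refine ⟨_, _, _, ?_, ?_, mul_ne_zero hc (mul_ne_zero (pow_ne_zero n h5) (pow_ne_zero m h6)),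
    HasLead.map ψ H1 H2 H3 (p4 := p4) (q4 := q4) (c4 := c4) ?_ (p5 := p5) (q5 := q5) (c5 := c5) ?_
      (p6 := p6) (q6 := q6) (c6 := c6) ?_
      hp.1 hp.2.1 hp.2.2.1 hp.2.2.2 hq.1 hq.2.1 hq.2.2.1 hq.2.2.2 hpos.1 H⟩
  · exact le_add_left (Nat.mul_pos hpos.2.1 hm)
  · exact le_add_right (hn.trans (Nat.le_mul_of_pos_left n hpos.1))
  · simpa [rP, fP] using H4
  · simpa [fP] using H5
  · simpa [gP, fP, map_ofNat] using H6

/-- The case where the terms `L2 F` of `r` and `L3 F²` of `g` dominate. -/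
theorem admissible_of_left_dominant {p1 p2 p3 m q1 q2 q3 n : ℕ} {l1 l2 l3 c : k}
    (H1 : HasLead p1 q1 l1 L1) (H2 : HasLead p2 q2 l2 L2) (H3 : HasLead p3 q3 l3 L3)
    (HF : HasLead m n c (L1 * L3 - L2 ^ 2))
    (hR : 2 * p1 ≤ p2 + m ∧ 2 * q1 ≤ q2 + n ∧ (2 * p1 < p2 + m ∨ 2 * q1 < q2 + n))
    (hG : p1 + p2 ≤ p3 + m ∧ q1 + q2 ≤ q3 + n ∧ (p1 + p2 < p3 + m ∨ q1 + q2 < q3 + n))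
    (hp : p1 ≤ p3 + 2 * m ∧ p2 ≤ 2 * (p3 + 2 * m) ∧ p2 ≤ p3 + m)
    (hq : q1 + 1 ≤ q3 + 2 * n ∧ q2 + 2 ≤ 2 * (q3 + 2 * n) ∧ q2 + 1 ≤ q3 + n)
    (hpos : 1 ≤ p3 ∧ 1 ≤ q3 ∧ 1 ≤ n) (hl3 : l3 ≠ 0) (hc : c ≠ 0) :
    Admissible L1 L2 L3 :=
  admissible_of_hasLead H1 H2 H3 HF
    ((H2.mul HF).add_low (H1.pow 2) (by omega))
    (((H3.mul (HF.pow 2)).add_low (((H1.mul H2).mul HF).const_mul 2) (by omega)).add_low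
      (H1.pow 3) (by omega) |>.congr rfl rfl rfl (by simp only [map_ofNat]; ring))
    (by omega) (by omega) (by omega) hc (mul_ne_zero hl3 (pow_ne_zero 2 hc))

/-- The case where the terms `L1²` of `r` and `L1³` of `g` dominate. -/
theorem admissible_of_right_dominant {p1 p2 p3 m q1 q2 q3 n : ℕ} {l1 l2 l3 c : k}
    (H1 : HasLead p1 q1 l1 L1) (H2 : HasLead p2 q2 l2 L2) (H3 : HasLead p3 q3 l3 L3)
    (HF : HasLead m n c (L1 * L3 - L2 ^ 2))
    (hR : p2 + m ≤ 2 * p1 ∧ q2 + n ≤ 2 * q1 ∧ (p2 + m < 2 * p1 ∨ q2 + n < 2 * q1))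
    (hG : p3 + 2 * m ≤ 3 * p1 ∧ q3 + 2 * n ≤ 3 * q1 ∧ (p3 + 2 * m < 3 * p1 ∨ q3 + 2 * n < 3 * q1))
    (hpos : 1 ≤ p1 ∧ 1 ≤ q1 ∧ 1 ≤ n) (hl1 : l1 ≠ 0) (hc : c ≠ 0) :
    Admissible L1 L2 L3 :=
  admissible_of_hasLead H1 H2 H3 HF
    ((H1.pow 2).add_low (H2.mul HF) (by omega) |>.congr rfl rfl rfl (add_comm _ _))
    (((H1.pow 3).add_low (((H1.mul H2).mul HF).const_mul 2) (by omega)).add_low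
      (H3.mul (HF.pow 2)) (by omega) |>.congr rfl rfl rfl (by simp only [map_ofNat]; ring))
    (by omega) (by omega) (by omega) hc (pow_ne_zero 3 hl1)

/-- The case where the leading terms of `L1 L3` and `L2²` do not cancel. -/
theorem admissible_of_no_cancellation {γ1 γ2 γ3 M : ℕ} {l1 l2 l3 c : k}
    (H1 : HasLead γ1 (γ1 + 1) l1 L1) (H2 : HasLead γ2 (γ2 + 1) l2 L2)
    (H3 : HasLead γ3 (γ3 + 1) l3 L3) (HF : HasLead M (M + 2) c (L1 * L3 - L2 ^ 2))
    (hM : γ1 + γ3 ≤ M ∧ 2 * γ2 ≤ M) (h1 : 1 ≤ γ1 ∧ γ1 ≤ 3) (h3 : 1 ≤ γ3)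
    (h123 : γ1 ≤ γ2 + γ3) (hl3 : l3 ≠ 0) (hc : c ≠ 0) :
    Admissible L1 L2 L3 :=
  admissible_of_left_dominant H1 H2 H3 HF (by omega) (by omega) (by omega) (by omega) (by omega)
    hl3 hc

end Admissible

/-- Leading data of the images `Y_i` of the variables `x_i`. -/
structure LeadTriple (u : k) (Y1 Y2 Y3 : MvPolynomial (Fin 3) k) : Prop where
  lead1 : HasLead 1 2 (u ^ 2) Y1
  lead2 : HasLead 2 3 (-u ^ 4) Y2
  lead3 : HasLead 3 4 (u ^ 6) Y3
  rel : Y1 * Y3 - Y2 ^ 2 = fP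
  cancel : HasLead 3 4 0 (Y3 * fP + Y1 * Y2)

namespace LeadTriple

variable {u : k} {Y1 Y2 Y3 : MvPolynomial (Fin 3) k}

/-- The unipotent substitution preserving `f` keeps the leading data. -/
theorem shift (T : LeadTriple u Y1 Y2 Y3) (hr : HasLead 1 1 (-u) (Y2 * fP + Y1 ^ 2)) (σ : k) :
    LeadTriple u Y1 (Y2 + C σ * Y1) (Y3 + C (2 * σ) * Y2 + C (σ ^ 2) * Y1) where
  lead1 := T.lead1
  lead2 := T.lead2.add_low (T.lead1.const_mul σ) (by omega)
  lead3 := (T.lead3.add_low (T.lead2.const_mul _) (by omega)).add_low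
    (T.lead1.const_mul _) (by omega)
  rel := by
    rw [← T.rel]; simp only [map_mul, map_pow, map_ofNat]; ring
  cancel := by
    refine (((T.cancel.add_low (hr.const_mul (2 * σ)) (by omega)).add_low
      ((T.lead1.pow 2).const_mul (-σ)) (by omega)).add_low
      ((T.lead1.mul HasLead.f).const_mul (σ ^ 2)) (by omega)).congr rfl rfl rfl ?_
    simp only [map_mul, map_pow, map_ofNat, map_neg]; ring

/-- Leading term of a combination of `Y1²`, `Y2`, `Y1`, `1` and `f`. -/
theorem exists_lead_low (T : LeadTriple u Y1 Y2 Y3) (hu : u ≠ 0) (k11 k2 k1 k0 c0 : k) :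
    (k11 = 0 ∧ k2 = 0 ∧ k1 = 0) ∨ ∃ (m n : ℕ) (c : k), 1 ≤ m ∧ m ≤ 2 ∧ 2 ≤ n ∧ n ≤ 4 ∧ c ≠ 0 ∧
      HasLead m n c (C k11 * Y1 ^ 2 + C k2 * Y2 + C k1 * Y1 + C k0 + C c0 * fP) := by
  have Hc := HasLead.const (k := k) k0
  have Hf := HasLead.f.const_mul (k := k) c0
  have H1 := T.lead1.const_mul k1
  have H2 := T.lead2.const_mul k2
  have H11 := (T.lead1.pow 2).const_mul k11
  have hu2 : u ^ 2 ≠ 0 := pow_ne_zero _ hu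
  have hu4 : -u ^ 4 ≠ 0 := neg_ne_zero.2 (pow_ne_zero _ hu)
  by_cases h11 : k11 = 0
  · subst h11
    by_cases h2 : k2 = 0
    · subst h2
      by_cases h1 : k1 = 0
      · exact Or.inl ⟨rfl, rfl, h1⟩
      · exact Or.inr ⟨1, 2, _, by omega, by omega, by omega, by omega, mul_ne_zero h1 hu2,
          ((H1.add_low Hc (by omega)).add_low Hf (by omega)).congr rfl rfl rfl (by simp)⟩
    · exact Or.inr ⟨2, 3, _, by omega, by omega, by omega, by omega, mul_ne_zero h2 hu4,
        (((H2.add_low H1 (by omega)).add_low Hc (by omega)).add_low Hf (by omega)).congr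
          rfl rfl rfl (by simp)⟩
  · exact Or.inr ⟨2, 4, _, by omega, by omega, by omega, by omega,
      mul_ne_zero h11 (pow_ne_zero 2 hu2),
      (((H11.add_low H2 (by omega)).add_low H1 (by omega)).add_low Hc (by omega)).add_low Hf
        (by omega)⟩

/-- Leading term of a combination of `Y1 Y2`, `Y3`, `Y1²`, `Y2`, `Y1`, `1` and `f`. -/
theorem exists_lead (T : LeadTriple u Y1 Y2 Y3) (hu : u ≠ 0) (k12 k3 k11 k2 k1 k0 c0 : k) :
    (k12 = 0 ∧ k3 = 0 ∧ k11 = 0 ∧ k2 = 0 ∧ k1 = 0) ∨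
      ∃ (m n : ℕ) (c : k), 1 ≤ m ∧ m ≤ 3 ∧ 2 ≤ n ∧ n ≤ 5 ∧ c ≠ 0 ∧
      HasLead m n c (C k12 * (Y1 * Y2) + C k3 * Y3 +
        (C k11 * Y1 ^ 2 + C k2 * Y2 + C k1 * Y1 + C k0 + C c0 * fP)) := by
  have Hlow : HasLead 3 4 0 (C k11 * Y1 ^ 2 + C k2 * Y2 + C k1 * Y1 + C k0 + C c0 * fP) :=
    ((((((T.lead1.pow 2).const_mul k11).weaken (by omega) (by omega) (by omega)).add_low
      (T.lead2.const_mul k2) (by omega)).add_low (T.lead1.const_mul k1) (by omega)).add_low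
      (HasLead.const k0) (by omega)).add_low (HasLead.f.const_mul c0) (by omega)
  have hu4 : -u ^ 4 ≠ 0 := neg_ne_zero.2 (pow_ne_zero _ hu)
  by_cases h12 : k12 = 0
  · subst h12
    by_cases h3 : k3 = 0
    · subst h3
      refine (T.exists_lead_low hu k11 k2 k1 k0 c0).imp (by simp) ?_
      rintro ⟨m, n, c, hm, hm', hn, hn', hc, H⟩
      exact ⟨m, n, c, hm, by omega, hn, by omega, hc, H.congr rfl rfl rfl (by simp)⟩
    · exact Or.inr ⟨3, 4, _, by omega, by omega, by omega, by omega,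
        mul_ne_zero h3 (pow_ne_zero 6 hu),
        ((T.lead3.const_mul k3).add Hlow).congr rfl rfl (add_zero _) (by simp)⟩
  · exact Or.inr ⟨3, 5, _, by omega, by omega, by omega, by omega,
      mul_ne_zero h12 (mul_ne_zero (pow_ne_zero 2 hu) hu4),
      (((T.lead1.mul T.lead2).const_mul k12).add_low (T.lead3.const_mul k3) (by omega)).add_low
        Hlow (by omega)⟩

end LeadTriple

section Types

variable {u : k} {Y1 Y2 Y3 : MvPolynomial (Fin 3) k}

/-- Type `(1, 2, 3)` with cancellation. -/
theorem admissible_type123 [CharZero k] (T : LeadTriple u Y1 Y2 Y3) (hu : u ≠ 0)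
    (hr : HasLead 1 1 (-u) (Y2 * fP + Y1 ^ 2))
    (hg : Y3 * fP ^ 2 + 2 * Y1 * Y2 * fP + Y1 ^ 3 = gP)
    {a b c e p q d1 d2 d3 : k} (ha : a ≠ 0) (hb : b ≠ 0) (hc : c ≠ 0) (hac : a * c = b ^ 2)
    (hβ : ¬ (a = c ^ 3 ∧ b = c ^ 2 ∧ e = 0 ∧ p = 0 ∧ q = 0 ∧ d1 = 0 ∧ d2 = 0 ∧ d3 = 0)) :
    Admissible (C a * Y1 + C d1) (C b * Y2 + C e * Y1 + C d2)
      (C c * Y3 + C p * Y2 + C q * Y1 + C d3) := by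
  have hu2 : u ^ 2 ≠ 0 := pow_ne_zero _ hu
  have hu4 : -u ^ 4 ≠ 0 := neg_ne_zero.2 (pow_ne_zero _ hu)
  have hu6 : u ^ 6 ≠ 0 := pow_ne_zero _ hu
  have hacC : (C a * C c : MvPolynomial (Fin 3) k) = C b ^ 2 := by
    rw [← map_mul, ← map_pow, hac]
  have H1 := (T.lead1.const_mul a).add_low (HasLead.const d1) (by omega)
  have H2 := ((T.lead2.const_mul b).add_low (T.lead1.const_mul e) (by omega)).add_low
    (HasLead.const d2) (by omega)
  have H3 := (((T.lead3.const_mul c).add_low (T.lead2.const_mul p) (by omega)).add_low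
    (T.lead1.const_mul q) (by omega)).add_low (HasLead.const d3) (by omega)
  rcases T.exists_lead hu (a * p - 2 * b * e) (c * d1) (a * q - e ^ 2) (d1 * p - 2 * b * d2)
    (a * d3 + d1 * q - 2 * e * d2) (d1 * d3 - d2 ^ 2) (a * c) with
    ⟨hp, hd1, hq, hd2, hd3⟩ | ⟨m, n, t, hm, hm', hn, hn', ht, H⟩
  · obtain rfl : d1 = 0 := by simpa [hc] using hd1
    obtain rfl : d2 = 0 := by
      by_contra h
      have h2 : (2 : k) ≠ 0 := two_ne_zero
      exact mul_ne_zero (mul_ne_zero h2 hb) h (by linear_combination -hd2)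
    obtain rfl : d3 = 0 := by simpa [ha] using hd3
    simp only [map_zero, add_zero, and_true] at *
    have hpC : C a * C p = 2 * C b * (C e : MvPolynomial (Fin 3) k) := by
      simpa [map_ofNat, sub_eq_zero] using congrArg (C (σ := Fin 3)) hp
    have hqC : C a * C q = (C e ^ 2 : MvPolynomial (Fin 3) k) := by
      simpa [sub_eq_zero] using congrArg (C (σ := Fin 3)) hq
    have hF : C a * Y1 * (C c * Y3 + C p * Y2 + C q * Y1) - (C b * Y2 + C e * Y1) ^ 2 =
        C (a * c) * fP := by
      rw [map_mul]
      linear_combination (C a * C c) * T.rel + Y2 ^ 2 * hacC + Y1 * Y2 * hpC + Y1 ^ 2 * hqC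
    have HF : HasLead 0 1 (a * c) (C a * Y1 * (C c * Y3 + C p * Y2 + C q * Y1) -
        (C b * Y2 + C e * Y1) ^ 2) := by
      rw [hF]; exact (HasLead.f.const_mul _).congr rfl rfl (mul_one _) rfl
    by_cases habc : a = b * c
    · have hbc : b = c ^ 2 := by
        have : b * (c ^ 2 - b) = 0 := by linear_combination hac - c * habc
        rcases mul_eq_zero.1 this with h | h
        · exact absurd h hb
        · linear_combination -h
      have ha' : a = c ^ 3 := by rw [habc, hbc]; ring
      have he : e ≠ 0 := by
        rintro rfl
        exact hβ ⟨ha', hbc, rfl, by simpa [ha] using hp, by simpa [ha] using hq⟩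
      have habcC : (C a : MvPolynomial (Fin 3) k) = C b * C c := by rw [habc, map_mul]
      have haC : (C a : MvPolynomial (Fin 3) k) = C c ^ 3 := by rw [ha', map_pow]
      have hbC : (C b : MvPolynomial (Fin 3) k) = C c ^ 2 := by rw [hbc, map_pow]
      refine admissible_of_hasLead H1 H2 H3 HF (p4 := 1) (q4 := 3) (p6 := 1) (q6 := 4)
        (c4 := a * c * e * u ^ 2) (c6 := a * c ^ 2 * e ^ 2 * u ^ 2) ?_ ?_
        (by omega) (by omega) (by omega) (mul_ne_zero ha hc)
        (mul_ne_zero (mul_ne_zero (mul_ne_zero ha (pow_ne_zero 2 hc)) (pow_ne_zero 2 he)) hu2)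
      · rw [hF]
        refine (((T.lead1.mul HasLead.f).const_mul (a * c * e)).add_low (hr.const_mul (a ^ 2))
          (by omega)).congr rfl rfl (by ring) ?_
        simp only [map_mul, map_pow, haC, hbC]; ring
      · rw [hF]
        refine ((((T.lead1.mul (HasLead.f.pow 2)).const_mul (a * c ^ 2 * e ^ 2)).add_low
          ((hr.mul HasLead.f).const_mul (2 * a ^ 2 * c * e)) (by omega)).add_low
          (HasLead.g.const_mul (a ^ 3)) (by omega)).congr rfl rfl (by ring) ?_
        simp only [map_mul, map_pow, map_ofNat]
        linear_combination (-C a ^ 3) * hg + C a ^ 2 * Y3 * fP ^ 2 * haC +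
          (2 * C a ^ 2 * Y1 * Y2 * fP + 2 * C a * C c * C e * Y2 * fP ^ 2) * habcC -
          C a * C c ^ 2 * Y2 * fP ^ 2 * hpC - C a * C c ^ 2 * Y1 * fP ^ 2 * hqC
    · refine admissible_of_hasLead H1 H2 H3 HF (p4 := 2) (q4 := 4) (p6 := 3) (q6 := 6)
        (c4 := a * (b * c - a) * -u ^ 4) (c6 := a * (b * c - a) ^ 2 * u ^ 6) ?_ ?_
        (by omega) (by omega) (by omega) (mul_ne_zero ha hc)
        (mul_ne_zero (mul_ne_zero ha (pow_ne_zero 2 (sub_ne_zero.2 (Ne.symm habc)))) hu6)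
      · rw [hF]
        refine ((((T.lead2.mul HasLead.f).const_mul (a * (b * c - a))).add_low
          ((T.lead1.mul HasLead.f).const_mul (a * c * e)) (by omega)).add_low
          (hr.const_mul (a ^ 2)) (by omega)).congr rfl rfl (by ring) ?_
        simp only [map_mul, map_pow, map_sub]; ring
      · rw [hF]
        have hlead := ((T.lead3.mul (HasLead.f.pow 2)).const_mul (a ^ 2 * c ^ 3 - a ^ 3)).add
          (((T.lead1.mul T.lead2).mul HasLead.f).const_mul (2 * a ^ 2 * b * c - 2 * a ^ 3))
        refine ((((hlead.add_low
          ((T.lead2.mul (HasLead.f.pow 2)).const_mul (a ^ 2 * c ^ 2 * p)) (by omega)).add_low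
          ((T.lead1.mul (HasLead.f.pow 2)).const_mul (a ^ 2 * c ^ 2 * q)) (by omega)).add_low
          (((T.lead1.pow 2).mul HasLead.f).const_mul (2 * a ^ 2 * c * e)) (by omega)).add_low
          (HasLead.g.const_mul (a ^ 3)) (by omega)).congr rfl rfl ?_ ?_
        · linear_combination (a * c ^ 2 * u ^ 6) * hac
        · simp only [map_mul, map_pow, map_sub, map_ofNat]
          rw [← hg]
          ring
  · refine admissible_of_left_dominant H1 H2 H3 (H.congr rfl rfl rfl ?_) (by omega) (by omega)
      (by omega) (by omega) (by omega) (mul_ne_zero hc hu6) ht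
    simp only [map_mul, map_add, map_sub, map_pow, map_ofNat]
    linear_combination (-(C a * C c)) * T.rel - Y2 ^ 2 * hacC

/-- Type `(3, 2, 1)` with cancellation. -/
theorem admissible_type321 (T : LeadTriple u Y1 Y2 Y3) (hu : u ≠ 0)
    {a b c e p q d1 d2 d3 : k} (ha : a ≠ 0) (hc : c ≠ 0) (hac : a * c = b ^ 2) :
    Admissible (C a * Y3 + C p * Y2 + C q * Y1 + C d1) (C b * Y2 + C e * Y1 + C d2)
      (C c * Y1 + C d3) := by
  have hacC : (C a * C c : MvPolynomial (Fin 3) k) = C b ^ 2 := by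
    rw [← map_mul, ← map_pow, hac]
  have H3 := (T.lead1.const_mul c).add_low (HasLead.const d3) (by omega)
  have H2 := ((T.lead2.const_mul b).add_low (T.lead1.const_mul e) (by omega)).add_low
    (HasLead.const d2) (by omega)
  have H1 := (((T.lead3.const_mul a).add_low (T.lead2.const_mul p) (by omega)).add_low
    (T.lead1.const_mul q) (by omega)).add_low (HasLead.const d1) (by omega)
  have hF : ∃ (m n : ℕ) (t : k), m ≤ 3 ∧ 1 ≤ n ∧ n ≤ 5 ∧ t ≠ 0 ∧
      HasLead m n t ((C a * Y3 + C p * Y2 + C q * Y1 + C d1) * (C c * Y1 + C d3) -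
        (C b * Y2 + C e * Y1 + C d2) ^ 2) := by
    have hexp : (C a * Y3 + C p * Y2 + C q * Y1 + C d1) * (C c * Y1 + C d3) -
        (C b * Y2 + C e * Y1 + C d2) ^ 2 =
        C (p * c - 2 * b * e) * (Y1 * Y2) + C (a * d3) * Y3 + (C (q * c - e ^ 2) * Y1 ^ 2 +
        C (p * d3 - 2 * b * d2) * Y2 + C (d1 * c + q * d3 - 2 * e * d2) * Y1 +
        C (d1 * d3 - d2 ^ 2) + C (a * c) * fP) := by
      simp only [map_mul, map_add, map_sub, map_pow, map_ofNat]
      linear_combination (C a * C c) * T.rel + Y2 ^ 2 * hacC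
    rw [hexp]
    rcases T.exists_lead hu (p * c - 2 * b * e) (a * d3) (q * c - e ^ 2) (p * d3 - 2 * b * d2)
      (d1 * c + q * d3 - 2 * e * d2) (d1 * d3 - d2 ^ 2) (a * c) with
      ⟨h1, h2, h3, h4, h5⟩ | ⟨m, n, t, hm, hm', hn, hn', ht, H⟩
    · refine ⟨0, 1, _, by omega, by omega, by omega, mul_ne_zero ha hc,
        (HasLead.f.const_mul (a * c)).add_low (HasLead.const (d1 * d3 - d2 ^ 2)) (by omega)
        |>.congr rfl rfl (mul_one _) ?_⟩
      rw [h1, h2, h3, h4, h5]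
      simp only [map_zero]
      ring
    · exact ⟨m, n, t, hm', by omega, hn', ht, H⟩
  obtain ⟨m, n, t, hm, hn, hn', ht, HF⟩ := hF
  exact admissible_of_right_dominant H1 H2 H3 HF (by omega) (by omega) (by omega)
    (mul_ne_zero ha (pow_ne_zero 6 hu)) ht

end Types

section Tie

variable {u : k} {Y1 Y2 Y3 : MvPolynomial (Fin 3) k}

theorem admissible_scale {N1 N2 N3 Φ : MvPolynomial (Fin 3) k} {v w t c1 c2 c3 c4 c5 c6 : k}
    {p4 p6 q4 q6 : ℕ} (hN : N1 * N3 - N2 ^ 2 = C v * Φ) (hwv : w * v = 1) (ht : t ≠ 0)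
    (H1 : HasLead 3 4 c1 N1) (H2 : HasLead 3 4 c2 N2) (H3 : HasLead 3 4 c3 N3)
    (H5 : HasLead 3 4 c5 Φ) (H4 : HasLead p4 q4 c4 (N2 * Φ + N1 ^ 2))
    (H6 : HasLead p6 q6 c6 (N3 * Φ ^ 2 + 2 * N1 * N2 * Φ + N1 ^ 3))
    (hp : 3 ≤ p6 ∧ p4 ≤ p6) (hq : 5 ≤ q6 ∧ q4 + 1 ≤ q6) (h5 : c5 ≠ 0) (h6 : c6 ≠ 0) :
    Admissible (C (w * t ^ 3) * N1) (C (w * t ^ 2) * N2) (C (w * t) * N3) := by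
  have hw : w ≠ 0 := left_ne_zero_of_mul_eq_one hwv
  have hwvC : (C w * C v : MvPolynomial (Fin 3) k) = 1 := by rw [← map_mul, hwv, map_one]
  have hF : C (w * t ^ 3) * N1 * (C (w * t) * N3) - (C (w * t ^ 2) * N2) ^ 2 =
      C (w * t ^ 4) * Φ := by
    simp only [map_mul, map_pow]
    linear_combination C w ^ 2 * C t ^ 4 * hN + C w * C t ^ 4 * Φ * hwvC
  refine admissible_of_hasLead (H1.const_mul _) (H2.const_mul _) (H3.const_mul _)
    (c4 := w ^ 2 * t ^ 6 * c4) (c5 := w * t ^ 4 * c5) (c6 := w ^ 3 * t ^ 9 * c6)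
    (p4 := p4) (q4 := q4) (p5 := 3) (q5 := 4) (p6 := p6) (q6 := q6) ?_ ?_ ?_
    (by omega) (by omega) (by omega) (by simp [hw, ht, h5]) (by simp [hw, ht, h6])
  · rw [hF]; exact H5.const_mul _
  · rw [hF]
    refine (H4.const_mul (w ^ 2 * t ^ 6)).congr rfl rfl rfl ?_
    simp only [map_mul, map_pow]; ring
  · rw [hF]
    refine (H6.const_mul (w ^ 3 * t ^ 9)).congr rfl rfl rfl ?_
    simp only [map_mul, map_pow]; ring

/-- Leading term of the cubic form attached to `g` when all top terms cancel. -/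
theorem hasLead_cubic (T : LeadTriple u Y1 Y2 Y3) {v h m1 m2 m3 : k}
    (hm : m1 + m3 - 2 * m2 = -v) (z1 z0 ω : k) :
    HasLead 6 8 (-v * (u ^ 6) ^ 2)
      ((Y3 - C (2 * h) * Y2 + C (h ^ 2) * Y1 + C m3) *
          (-(Y3 + C h * Y2 + C z1 * Y1 + C z0) + C ω * fP) ^ 2 +
        2 * (Y3 + C m1) * (Y3 - C h * Y2 + C m2) *
          (-(Y3 + C h * Y2 + C z1 * Y1 + C z0) + C ω * fP) + (Y3 + C m1) ^ 3) := by
  have hmC : (C m3 : MvPolynomial (Fin 3) k) = 2 * C m2 - C m1 - C v := by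
    rw [show m3 = 2 * m2 - m1 - v by linear_combination hm]; simp [map_ofNat]
  have Hf := HasLead.f (k := k)
  have hfY := T.rel
  have Hy3 := (T.lead1.const_mul (h ^ 2)).add_low (HasLead.const m3) (by omega)
  have Hz := (T.lead1.const_mul z1).add_low (HasLead.const z0) (by omega)
  have HN3 := ((T.lead3.add_low (T.lead2.const_mul (-2 * h)) (by omega)).add_low
    (T.lead1.const_mul (h ^ 2)) (by omega)).add_low (HasLead.const m3) (by omega)
  have HN2 := (T.lead2.const_mul (-h)).add_low (HasLead.const m2) (by omega)
  have HZ := (T.lead2.const_mul h).add_low Hz (by omega)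
  have HD := (T.lead1.const_mul (-h ^ 2 - z1)).add_low
    (HasLead.const (m1 + m2 - m3 - z0)) (by omega)
  have HY := (((((Hy3.mul Hz).const_mul 2).add (Hz.pow 2)).add_low
    (Hz.const_mul (-2 * m1 - 2 * m2)) (by omega)).add_low
    (HasLead.const (3 * m1 ^ 2 - 2 * m1 * m2)) (by omega)).add_low
    (T.lead2.const_mul (2 * h * (m3 - m2))) (by omega)
  have HYz := ((T.lead2.mul Hz).const_mul (2 * h)).add_low (Hz.pow 2) (by omega)
  have HV := (((Hy3.mul (HZ.pow 2)).add
    ((T.lead2.mul HYz).const_mul (-2 * h))).add_low ((HN2.mul HZ).const_mul (-2 * m1))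
    (by omega)).add_low (HasLead.const (m1 ^ 3)) (by omega)
  have Hy3' := (T.lead2.const_mul (-2 * h)).add_low Hy3 (by omega)
  have HM := ((Hy3'.mul HZ).const_mul (-1)).add_low (HN2.const_mul m1) (by omega)
  have HD3 := (T.lead3.mul HD).congr (m' := 4) (n' := 6) rfl rfl rfl rfl
  have HM' := (HM.add HD3).mul (Hf.const_mul (2 * ω))
  have HS := (((((((T.lead3.pow 2).const_mul (-v)).add_low ((T.lead3.mul Hf).const_mul (h ^ 2))
    (by omega)).add_low ((T.lead2.mul Hf).const_mul (2 * h ^ 3)) (by omega)).add_low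
    (T.lead3.mul HY) (by omega)).add_low HV (by omega)).add_low HM' (by omega)).add_low
    (HN3.mul ((Hf.const_mul ω).pow 2)) (by omega)
  refine HS.congr rfl rfl rfl ?_
  simp only [map_mul, map_pow, map_add, map_sub, map_neg, map_one, map_ofNat]
  linear_combination (-(C h ^ 2 * Y3 + 2 * C h ^ 3 * Y2)) * hfY - Y3 ^ 2 * hmC

end Tie

section TieCases

variable {u : k} {Y1 Y2 Y3 : MvPolynomial (Fin 3) k}

theorem hasLead_quadratic_of_generic {l3 a1 a2 a3 b z0 c : k}
    {y1 y2 y3 z E : MvPolynomial (Fin 3) k} (HY : HasLead 3 4 l3 Y3)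
    (H1 : HasLead 1 2 a1 y1) (H2 : HasLead 2 3 a2 y2) (H3 : HasLead 2 3 a3 y3)
    (Hz : HasLead 2 3 z0 z) (HE : HasLead 2 4 c E) (Hb : HasLead 1 2 b (y1 + y3 - 2 * y2)) :
    HasLead 5 8 (l3 * c) ((Y3 + y2) * (-(Y3 + z) + E) + (Y3 + y1) ^ 2) ∧
      HasLead 7 12 (l3 * c ^ 2) ((Y3 + y3) * (-(Y3 + z) + E) ^ 2 +
        2 * (Y3 + y1) * (Y3 + y2) * (-(Y3 + z) + E) + (Y3 + y1) ^ 3) := by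
  have Hd := ((H2.add Hz).const_mul (-1)).add_low (H1.const_mul 2) (by omega)
  have Hq := ((H2.mul Hz).const_mul (-1)).add_low (H1.pow 2) (by omega)
  have Hd' := (((H3.add Hz).const_mul (-1)).add H2).add_low H1 (by omega)
  have Hq' := ((H3.mul Hz).const_mul (-1)).add_low (H1.mul H2) (by omega)
  have Hc := ((((((H3.mul Hz).const_mul 2).add ((Hz.pow 2).congr (m' := 2 + 2) (n' := 3 + 3)
    rfl rfl rfl rfl)).add ((H2.mul Hz).const_mul (-2))).add_low
    ((H1.mul (H2.add Hz)).const_mul (-2)) (by omega)).add_low ((H1.pow 2).const_mul 3)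
    (by omega))
  have Hl := ((H3.mul (Hz.pow 2)).add_low ((H1.mul (H2.mul Hz)).const_mul (-2))
    (by omega)).add_low (H1.pow 3) (by omega)
  constructor
  · refine ((((HY.add_low H2 (by omega)).mul HE).add_low (HY.mul Hd) (by omega)).add_low Hq
      (by omega)).congr rfl rfl rfl ?_
    simp only [map_neg, map_one, map_ofNat]; ring
  · refine ((((((HY.add_low H3 (by omega)).mul (HE.pow 2)).add_low
      ((HE.mul ((HY.mul Hd').add_low Hq' (by omega))).const_mul 2) (by omega)).add_low
      ((HY.pow 2).mul Hb) (by omega)).add_low (HY.mul Hc) (by omega)).add_low Hl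
      (by omega)).congr rfl rfl rfl ?_
    simp only [map_neg, map_one, map_ofNat]; ring

theorem hasLead_quadratic_of_const {l3 a2 a3 b z0 c : k} (m1 : k)
    {y2 y3 z E : MvPolynomial (Fin 3) k} (HY : HasLead 3 4 l3 Y3)
    (H2 : HasLead 2 3 a2 y2) (H3 : HasLead 2 3 a3 y3)
    (Hz : HasLead 2 3 z0 z) (HE : HasLead 0 1 c E) (Hb : HasLead 1 2 b (C m1 + y3 - 2 * y2)) :
    HasLead 5 7 (l3 * (-(a2 + z0))) ((Y3 + y2) * (-(Y3 + z) + E) + (Y3 + C m1) ^ 2) ∧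
      HasLead 7 10 (l3 ^ 2 * b + l3 * (2 * (a3 * z0) + z0 ^ 2 - 2 * (a2 * z0)))
        ((Y3 + y3) * (-(Y3 + z) + E) ^ 2 +
        2 * (Y3 + C m1) * (Y3 + y2) * (-(Y3 + z) + E) + (Y3 + C m1) ^ 3) := by
  have Hd := ((H2.add Hz).const_mul (-1)).add_low (HasLead.const (2 * m1)) (by omega)
  have Hq := ((H2.mul Hz).const_mul (-1)).add_low (HasLead.const (m1 ^ 2)) (by omega)
  have Hd' := (((H3.add Hz).const_mul (-1)).add H2).add_low (HasLead.const m1) (by omega)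
  have Hq' := ((H3.mul Hz).const_mul (-1)).add_low (H2.const_mul m1) (by omega)
  have Hc := ((((((H3.mul Hz).const_mul 2).add ((Hz.pow 2).congr (m' := 2 + 2) (n' := 3 + 3)
    rfl rfl rfl rfl)).add ((H2.mul Hz).const_mul (-2))).add_low
    ((H2.add Hz).const_mul (-2 * m1)) (by omega)).add_low (HasLead.const (3 * m1 ^ 2))
    (by omega))
  have Hl := ((H3.mul (Hz.pow 2)).add_low ((H2.mul Hz).const_mul (-2 * m1))
    (by omega)).add_low (HasLead.const (m1 ^ 3)) (by omega)
  constructor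
  · refine (((HY.mul Hd).add_low ((HY.add_low H2 (by omega)).mul HE) (by omega)).add_low Hq
      (by omega)).congr rfl rfl (by ring) ?_
    simp only [map_neg, map_mul, map_pow, map_one, map_ofNat]; ring
  · refine (((((((HY.pow 2).mul Hb).congr (m' := 7) (n' := 10) rfl rfl rfl rfl).add
      ((HY.mul Hc).congr (m' := 7) (n' := 10) rfl rfl rfl rfl)).add_low
      ((HY.add_low H3 (by omega)).mul (HE.pow 2)) (by omega)).add_low
      ((HE.mul ((HY.mul Hd').add_low Hq' (by omega))).const_mul 2) (by omega)).add_low Hl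
      (by omega)).congr rfl rfl (by ring) ?_
    simp only [map_neg, map_mul, map_pow, map_one, map_ofNat]; ring

theorem hasLead_quadratic_of_cancel (T : LeadTriple u Y1 Y2 Y3) (h m1 m2 η z0 ω : k) :
    HasLead 4 6 (h ^ 2 * (η + 1) * (-u ^ 4) ^ 2)
      ((Y3 - C h * Y2 + C m2) *
        (-(Y3 + C h * Y2 + C (-h ^ 2 * η) * Y1 + C z0) + C ω * fP) + (Y3 + C m1) ^ 2) := by
  have Hf := HasLead.f (k := k)
  have HN2 := (T.lead3.add_low (T.lead2.const_mul (-h)) (by omega)).add_low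
    (HasLead.const m2) (by omega)
  have HL := ((T.lead2.const_mul (h * (z0 - m2))).add_low
    (T.lead1.const_mul (m2 * h ^ 2 * η)) (by omega)).add_low
    (HasLead.const (m1 ^ 2 - m2 * z0)) (by omega)
  refine (((((((T.lead2.pow 2).const_mul (h ^ 2 * (η + 1))).add_low
    ((HN2.mul Hf).const_mul ω) (by omega)).add_low (T.lead3.const_mul (2 * m1 - m2 - z0))
    (by omega)).add_low (Hf.const_mul (h ^ 2 * η)) (by omega)).add_low
    ((T.lead2.mul T.lead1).const_mul (-h ^ 3 * η)) (by omega)).add_low HL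
    (by omega)).congr rfl rfl rfl ?_
  simp only [map_mul, map_pow, map_add, map_sub, map_neg, map_one, map_ofNat]
  linear_combination (-C h ^ 2 * C η) * T.rel

theorem admissible_tie (T : LeadTriple u Y1 Y2 Y3) (hu : u ≠ 0) {v w h p t e1 e2 e3 : k}
    (hwv : w * v = 1) (hh : h ≠ 0) (ht : t ≠ 0) (he : e1 + e3 - 2 * e2 = -v) :
    Admissible (C (w * t ^ 3) * (Y3 + C p * Y1 + C e1))
      (C (w * t ^ 2) * (Y3 - C h * Y2 + C p * Y1 + C e2))
      (C (w * t) * (Y3 - C (2 * h) * Y2 + C (h ^ 2 + p) * Y1 + C e3)) := by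
  have hv : v ≠ 0 := right_ne_zero_of_mul_eq_one hwv
  have hw : w ≠ 0 := left_ne_zero_of_mul_eq_one hwv
  have he3 : e3 = 2 * e2 - e1 - v := by linear_combination he
  have hwvC : (C w * C v : MvPolynomial (Fin 3) k) = 1 := by rw [← map_mul, hwv, map_one]
  have Hy1 := (T.lead1.const_mul p).add_low (HasLead.const e1) (by omega)
  have Hy2 := ((T.lead2.const_mul (-h)).add_low (T.lead1.const_mul p) (by omega)).add_low
    (HasLead.const e2) (by omega)
  have Hy3 := ((T.lead2.const_mul (-(2 * h))).add_low (T.lead1.const_mul (h ^ 2 + p))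
    (by omega)).add_low (HasLead.const e3) (by omega)
  have Hz := ((T.lead2.const_mul (2 * w * h * (e1 - e2))).add_low
    (T.lead1.const_mul (p - w * h ^ 2 * e1)) (by omega)).add_low
    (HasLead.const (e1 + w * (e1 - e2) ^ 2)) (by omega)
  have Hb := (T.lead1.const_mul (h ^ 2)).add_low (HasLead.const (-v)) (by omega)
  have HE := ((T.lead1.pow 2).const_mul p).add_low HasLead.f (by omega)
  have H5 := ((T.lead3.add_low Hz (by omega)).const_mul (-1)).add_low
    (HE.const_mul (w * h ^ 2)) (by omega)
  have hN : (Y3 + C p * Y1 + C e1) * (Y3 - C (2 * h) * Y2 + C (h ^ 2 + p) * Y1 + C e3) -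
      (Y3 - C h * Y2 + C p * Y1 + C e2) ^ 2 = C v * (C (-1) * (Y3 +
        (C (2 * w * h * (e1 - e2)) * Y2 + C (p - w * h ^ 2 * e1) * Y1 +
          C (e1 + w * (e1 - e2) ^ 2))) + C (w * h ^ 2) * (C p * Y1 ^ 2 + fP)) := by
    subst he3
    simp only [map_mul, map_pow, map_add, map_sub, map_neg, map_one, map_ofNat]
    linear_combination C h ^ 2 * T.rel - (-2 * C h * (C e1 - C e2) * Y2 + C h ^ 2 * C e1 * Y1 -
      (C e1 - C e2) ^ 2 + C h ^ 2 * (C p * Y1 ^ 2 + fP)) * hwvC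
  have HN1 := (T.lead3.add_low Hy1 (by omega)).congr (h' := Y3 + C p * Y1 + C e1)
    rfl rfl rfl (by ring)
  have HN2 := (T.lead3.add_low Hy2 (by omega)).congr
    (h' := Y3 - C h * Y2 + C p * Y1 + C e2) rfl rfl rfl (by rw [map_neg]; ring)
  have HN3 := (T.lead3.add_low Hy3 (by omega)).congr
    (h' := Y3 - C (2 * h) * Y2 + C (h ^ 2 + p) * Y1 + C e3) rfl rfl rfl (by rw [map_neg]; ring)
  have hu6 : u ^ 6 ≠ 0 := pow_ne_zero _ hu
  have h5 : (-1 : k) * u ^ 6 ≠ 0 := mul_ne_zero (neg_ne_zero.2 one_ne_zero) hu6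
  by_cases hp : p = 0
  · subst hp
    by_cases hd : 2 * w * (e1 - e2) = 1
    · have hd' : 2 * w * h * (e1 - e2) = h := by linear_combination h * hd
      have hη := hasLead_quadratic_of_cancel T h e1 e2 (w * e1) (e1 + w * (e1 - e2) ^ 2)
        (w * h ^ 2)
      have hc := hasLead_cubic T (h := h) he (-h ^ 2 * (w * e1)) (e1 + w * (e1 - e2) ^ 2)
        (w * h ^ 2)
      refine admissible_scale hN hwv ht HN1 HN2 HN3 H5 (hη.congr rfl rfl rfl ?_)
        (hc.congr rfl rfl rfl ?_) (by omega) (by omega) h5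
        (mul_ne_zero (neg_ne_zero.2 hv) (pow_ne_zero 2 hu6))
      all_goals
        rw [hd']
        simp only [map_neg, map_mul, map_pow, map_add, map_sub, map_zero, map_one]
        ring
    · have hq := hasLead_quadratic_of_const e1 T.lead3 Hy2 Hy3 Hz
        ((HasLead.f.const_mul (w * h ^ 2))) (Hb.congr rfl rfl rfl (by
          subst he3
          simp only [map_mul, map_pow, map_add, map_sub, map_neg, map_zero, map_ofNat]
          ring))
      refine admissible_scale hN hwv ht HN1 HN2 HN3 H5
        (hq.1.congr rfl rfl rfl ?_) (hq.2.congr rfl rfl ?_ ?_)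
        (by omega) (by omega) h5
        (mul_ne_zero (mul_ne_zero (pow_ne_zero 2 hh) (pow_ne_zero 2 (sub_ne_zero.2 hd)))
          (pow_ne_zero 14 hu))
      · simp only [map_neg, map_one, map_zero]; ring
      · ring
      · simp only [map_neg, map_one, map_zero]; ring
  · have hq := hasLead_quadratic_of_generic T.lead3 Hy1 Hy2 Hy3 Hz (HE.const_mul (w * h ^ 2))
      (Hb.congr rfl rfl rfl (by
        subst he3
        simp only [map_mul, map_pow, map_add, map_sub, map_neg, map_ofNat]
        ring))
    refine admissible_scale hN hwv ht HN1 HN2 HN3 H5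
      (hq.1.congr rfl rfl rfl ?_) (hq.2.congr rfl rfl rfl ?_)
      (by omega) (by omega) h5
      (mul_ne_zero hu6 (pow_ne_zero 2 (mul_ne_zero (mul_ne_zero hw (pow_ne_zero 2 hh))
        (mul_ne_zero hp (pow_ne_zero 2 (pow_ne_zero 2 hu))))))
    · simp only [map_neg, map_one]; ring
    · simp only [map_neg, map_one]; ring

end TieCases

section Type333

variable {u : k} {Y1 Y2 Y3 : MvPolynomial (Fin 3) k}

/-- Type `(3, 3, 3)` with cancellation, when the first form does not involve `Y2`. -/
theorem admissible_type333 [CharZero k] (T : LeadTriple u Y1 Y2 Y3) (hu : u ≠ 0)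
    {a b c e1 e2 e3 s2 s3 t1 t2 t3 : k} (ha : a ≠ 0) (hb : b ≠ 0) (hc : c ≠ 0)
    (hac : a * c = b ^ 2) (hdet : s2 * t3 - s3 * t2 + t1 * (s3 - s2) ≠ 0) :
    Admissible (C a * (Y3 + C t1 * Y1 + C e1)) (C b * (Y3 + C s2 * Y2 + C t2 * Y1 + C e2))
      (C c * (Y3 + C s3 * Y2 + C t3 * Y1 + C e3)) := by
  have hb2 : b ^ 2 ≠ 0 := pow_ne_zero 2 hb
  have hu4 : -u ^ 4 ≠ 0 := neg_ne_zero.2 (pow_ne_zero _ hu)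
  have hu6 : u ^ 6 ≠ 0 := pow_ne_zero _ hu
  have hacC : (C a * C c : MvPolynomial (Fin 3) k) = C b ^ 2 := by
    rw [← map_mul, ← map_pow, hac]
  have H1 := ((T.lead3.add_low (T.lead1.const_mul t1) (by omega)).add_low
    (HasLead.const e1) (by omega)).const_mul a
  have H2 := (((T.lead3.add_low (T.lead2.const_mul s2) (by omega)).add_low
    (T.lead1.const_mul t2) (by omega)).add_low (HasLead.const e2) (by omega)).const_mul b
  have H3 := (((T.lead3.add_low (T.lead2.const_mul s3) (by omega)).add_low
    (T.lead1.const_mul t3) (by omega)).add_low (HasLead.const e3) (by omega)).const_mul c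
  have hl1 := mul_ne_zero ha hu6
  have hl3 := mul_ne_zero hc hu6
  obtain ⟨τ, hτ⟩ : ∃ τ, τ = t1 + t3 - 2 * t2 := ⟨_, rfl⟩
  obtain ⟨ε, hε⟩ : ∃ ε, ε = e1 + e3 - 2 * e2 := ⟨_, rfl⟩
  have hF : C a * (Y3 + C t1 * Y1 + C e1) * (C c * (Y3 + C s3 * Y2 + C t3 * Y1 + C e3)) -
      (C b * (Y3 + C s2 * Y2 + C t2 * Y1 + C e2)) ^ 2 = C (b ^ 2) *
      (C (s3 - 2 * s2) * (Y2 * Y3) + C (τ - s2 ^ 2) * Y2 ^ 2 +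
        C (t1 * s3 - 2 * s2 * t2) * (Y1 * Y2) + C ε * Y3 +
        (C (t1 * t3 - t2 ^ 2) * Y1 ^ 2 + C (e1 * s3 - 2 * s2 * e2) * Y2 +
          C (t1 * e3 + e1 * t3 - 2 * t2 * e2) * Y1 + C (e1 * e3 - e2 ^ 2) + C τ * fP)) := by
    subst hτ hε
    simp only [map_mul, map_add, map_sub, map_pow, map_ofNat]
    linear_combination (Y3 + C t1 * Y1 + C e1) * (Y3 + C s3 * Y2 + C t3 * Y1 + C e3) * hacC +
      C b ^ 2 * (C t1 + C t3 - 2 * C t2) * T.rel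
  have Hlow : HasLead 3 4 0 (C (t1 * t3 - t2 ^ 2) * Y1 ^ 2 + C (e1 * s3 - 2 * s2 * e2) * Y2 +
      C (t1 * e3 + e1 * t3 - 2 * t2 * e2) * Y1 + C (e1 * e3 - e2 ^ 2) + C τ * fP) :=
    ((((((T.lead1.pow 2).const_mul _).weaken (by omega) (by omega) (by omega)).add_low
      (T.lead2.const_mul _) (by omega)).add_low (T.lead1.const_mul _) (by omega)).add_low
      (HasLead.const _) (by omega)).add_low (HasLead.f.const_mul _) (by omega)
  have K3 := (T.lead3.const_mul ε).add Hlow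
  have K12 := ((T.lead1.mul T.lead2).const_mul (t1 * s3 - 2 * s2 * t2))
  have K22 := ((T.lead2.pow 2).const_mul (τ - s2 ^ 2))
  have K23 := ((T.lead2.mul T.lead3).const_mul (s3 - 2 * s2))
  by_cases h23 : s3 - 2 * s2 = 0
  swap
  · refine admissible_of_left_dominant H1 H2 H3 (((((K23.add_low K22 (by omega)).add_low K12
      (by omega)).add_low K3 (by omega)).const_mul (b ^ 2)).congr rfl rfl rfl ?_) (by omega)
      (by omega) (by omega) (by omega) (by omega) hl3
      (mul_ne_zero hb2 (mul_ne_zero h23 (mul_ne_zero hu4 hu6)))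
    rw [hF]; ring
  by_cases h22 : τ - s2 ^ 2 = 0
  swap
  · refine admissible_of_left_dominant H1 H2 H3 ((((K22.add_low K12
      (by omega)).add_low K3 (by omega)).const_mul (b ^ 2)).congr rfl rfl rfl ?_) (by omega)
      (by omega) (by omega) (by omega) (by omega) hl3
      (mul_ne_zero hb2 (mul_ne_zero h22 (pow_ne_zero 2 hu4)))
    rw [hF, h23, map_zero]; ring
  by_cases h12 : t1 * s3 - 2 * s2 * t2 = 0
  swap
  · refine admissible_of_left_dominant H1 H2 H3 (((K12.add_low K3 (by omega)).const_mul
      (b ^ 2)).congr rfl rfl rfl ?_) (by omega)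
      (by omega) (by omega) (by omega) (by omega) hl3
      (mul_ne_zero hb2 (mul_ne_zero h12 (mul_ne_zero (pow_ne_zero 2 hu) hu4)))
    rw [hF, h23, h22, map_zero]; ring
  rw [h23, h22, h12] at hF
  simp only [map_zero, zero_mul, zero_add] at hF
  obtain rfl : s3 = 2 * s2 := by linear_combination h23
  have hs2τ : s2 * τ ≠ 0 := by
    rw [hτ]; intro h; exact hdet (by linear_combination h)
  by_cases h3 : ε = 0
  · have hlow : ∃ (m n : ℕ) (t : k), m ≤ 2 ∧ 1 ≤ n ∧ n ≤ 4 ∧ t ≠ 0 ∧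
        HasLead m n t (C (t1 * t3 - t2 ^ 2) * Y1 ^ 2 + C (e1 * (2 * s2) - 2 * s2 * e2) * Y2 +
          C (t1 * e3 + e1 * t3 - 2 * t2 * e2) * Y1 + C (e1 * e3 - e2 ^ 2) + C τ * fP) := by
      rcases T.exists_lead_low hu (t1 * t3 - t2 ^ 2) (e1 * (2 * s2) - 2 * s2 * e2)
        (t1 * e3 + e1 * t3 - 2 * t2 * e2) (e1 * e3 - e2 ^ 2) τ with
        ⟨h1, h2, h4⟩ | ⟨m, n, t, hm, hm', hn, hn', ht, H⟩
      · refine ⟨0, 1, τ, by omega, by omega, by omega, right_ne_zero_of_mul hs2τ,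
          ((HasLead.f.const_mul τ).add_low (HasLead.const (e1 * e3 - e2 ^ 2)) (by omega)).congr
          rfl rfl (mul_one _) ?_⟩
        rw [h1, h2, h4, map_zero]; ring
      · exact ⟨m, n, t, hm', by omega, hn', ht, H⟩
    obtain ⟨m, n, t, hm, hn, hn', ht, H⟩ := hlow
    refine admissible_of_right_dominant H1 H2 H3 ((H.const_mul (b ^ 2)).congr rfl rfl rfl ?_)
      (by omega) (by omega) (by omega) hl1 (mul_ne_zero hb2 ht)
    rw [hF, h3, map_zero]; ring
  · have hc' : c = b ^ 2 / a := by field_simp; linear_combination hac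
    by_cases htie : b ^ 3 * ε + a ^ 2 = 0
    · have h2 : (2 : k) ≠ 0 := two_ne_zero
      have ht12 : t2 = t1 := by
        have : (2 * s2) * (t1 - t2) = 0 := by linear_combination h12
        rcases mul_eq_zero.1 this with h | h
        · exact absurd h (mul_ne_zero h2 (left_ne_zero_of_mul hs2τ))
        · linear_combination -h
      have ht3 : t3 = s2 ^ 2 + t1 := by linear_combination h22 - hτ + 2 * ht12
      subst ht12 ht3
      have := admissible_tie T hu (v := -ε) (w := b ^ 3 / a ^ 2) (h := -s2) (p := t2)
        (t := a / b) (e1 := e1) (e2 := e2) (e3 := e3)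
        (by field_simp; linear_combination -htie) (neg_ne_zero.2 (left_ne_zero_of_mul hs2τ))
        (div_ne_zero ha hb) (by rw [hε]; ring)
      convert this using 2
      · congr 1; field_simp
      · congr 1; field_simp
      · simp only [map_neg]; ring
      · congr 1; rw [hc']; field_simp
      · simp only [map_neg, map_mul, map_add, map_pow]; ring
    · have HF := (K3.const_mul (b ^ 2)).congr rfl rfl rfl hF.symm
      refine admissible_of_hasLead H1 H2 H3 HF (p4 := 6) (q4 := 8) (p6 := 9) (q6 := 12)
        (((H2.mul HF).add ((H1.pow 2).congr (m' := 6) (n' := 8) rfl rfl rfl rfl)))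
        (c6 := (b ^ 3 * ε + a ^ 2) ^ 2 / a * u ^ 18)
        (((((H3.mul (HF.pow 2)).congr (m' := 9) (n' := 12) rfl rfl rfl rfl).add
          ((((H1.mul H2).mul HF).const_mul 2).congr (m' := 9) (n' := 12) rfl rfl rfl rfl)).add
          ((H1.pow 3).congr (m' := 9) (n' := 12) rfl rfl rfl rfl)).congr rfl rfl ?_ ?_)
        (by omega) (by omega) (by omega) ?_ ?_
      · rw [hc']; field_simp; ring
      · simp only [map_ofNat]; ring
      · simpa [hb] using ⟨h3, hu⟩
      · exact mul_ne_zero (div_ne_zero (pow_ne_zero 2 htie) ha) (pow_ne_zero 18 hu)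

end Type333

section Affine

variable {u : k} {Y1 Y2 Y3 : MvPolynomial (Fin 3) k}

/-- Leading term of a nonconstant linear form in the `Y_i`. -/
theorem LeadTriple.exists_lead_linear (T : LeadTriple u Y1 Y2 Y3) (hu : u ≠ 0) (p q r d : k)
    (hne : ¬ (p = 0 ∧ q = 0 ∧ r = 0)) :
    ∃ (γ : ℕ) (l : k), (1 ≤ γ ∧ γ ≤ 3) ∧ l ≠ 0 ∧
      HasLead γ (γ + 1) l (C p * Y1 + C q * Y2 + C r * Y3 + C d) ∧
      (γ = 1 → q = 0 ∧ r = 0 ∧ l = p * u ^ 2) ∧ (γ = 2 → r = 0 ∧ l = q * -u ^ 4) ∧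
      (γ = 3 → l = r * u ^ 6) := by
  by_cases hr : r = 0
  · subst hr
    by_cases hq : q = 0
    · subst hq
      have hp : p ≠ 0 := fun h => hne ⟨h, rfl, rfl⟩
      refine ⟨1, p * u ^ 2, by omega, mul_ne_zero hp (pow_ne_zero _ hu), ?_, by simp, by simp,
        by simp⟩
      exact ((T.lead1.const_mul p).add_low (HasLead.const d) (by omega)).congr rfl rfl rfl
        (by simp)
    · refine ⟨2, q * -u ^ 4, by omega, mul_ne_zero hq (neg_ne_zero.2 (pow_ne_zero _ hu)), ?_,
        by simp, by simp, by simp⟩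
      exact (((T.lead2.const_mul q).add_low (T.lead1.const_mul p) (by omega)).add_low
        (HasLead.const d) (by omega)).congr rfl rfl rfl (by rw [map_zero]; ring)
  · refine ⟨3, r * u ^ 6, by omega, mul_ne_zero hr (pow_ne_zero _ hu), ?_, by simp, by simp,
      by simp⟩
    exact ((((T.lead3.const_mul r).add_low (T.lead1.const_mul p) (by omega)).add_low
      (T.lead2.const_mul q) (by omega)).add_low (HasLead.const d) (by omega)).congr rfl rfl rfl
      (by ring)

/-- Type `(3, 3, 3)` with cancellation. -/
theorem admissible_type333' [CharZero k] (T : LeadTriple u Y1 Y2 Y3) (hu : u ≠ 0)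
    (hr : HasLead 1 1 (-u) (Y2 * fP + Y1 ^ 2))
    {p1 p2 p3 q1 q2 q3 r1 r2 r3 d1 d2 d3 : k} (h1 : r1 ≠ 0) (h2 : r2 ≠ 0) (h3 : r3 ≠ 0)
    (h13 : r1 * r3 = r2 ^ 2)
    (hdet : p1 * (q2 * r3 - q3 * r2) - q1 * (p2 * r3 - p3 * r2) + r1 * (p2 * q3 - p3 * q2) ≠ 0) :
    Admissible (C p1 * Y1 + C q1 * Y2 + C r1 * Y3 + C d1)
      (C p2 * Y1 + C q2 * Y2 + C r2 * Y3 + C d2) (C p3 * Y1 + C q3 * Y2 + C r3 * Y3 + C d3) := by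
  have hdvd : ∀ {r : k}, r ≠ 0 → ∀ x, ∃ y, x = r * y :=
    fun h x => ⟨_, (mul_div_cancel₀ x h).symm⟩
  obtain ⟨t1, rfl⟩ := hdvd h1 p1
  obtain ⟨t2, rfl⟩ := hdvd h2 p2
  obtain ⟨t3, rfl⟩ := hdvd h3 p3
  obtain ⟨e1, rfl⟩ := hdvd h1 d1
  obtain ⟨e2, rfl⟩ := hdvd h2 d2
  obtain ⟨e3, rfl⟩ := hdvd h3 d3
  obtain ⟨σ, rfl⟩ := hdvd (mul_ne_zero h1 (two_ne_zero (α := k))) q1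
  obtain ⟨s2, rfl⟩ := hdvd h2 q2
  obtain ⟨s3, rfl⟩ := hdvd h3 q3
  have := admissible_type333 (T.shift hr σ) hu h1 h2 h3 h13 (e1 := e1) (e2 := e2) (e3 := e3)
    (s2 := s2 - 2 * σ) (s3 := s3 - 2 * σ) (t1 := t1 - σ ^ 2) (t2 := t2 - s2 * σ + σ ^ 2)
    (t3 := t3 - s3 * σ + σ ^ 2) (fun h => hdet (by linear_combination (-r1 * r2 * r3) * h))
  convert this using 1 <;>
  · simp only [map_mul, map_add, map_sub, map_pow, map_ofNat]
    ring

theorem admissible_of_isUnit_det [CharZero k] (T : LeadTriple u Y1 Y2 Y3) (hu : u ≠ 0)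
    (hr : HasLead 1 1 (-u) (Y2 * fP + Y1 ^ 2))
    (hg : Y3 * fP ^ 2 + 2 * Y1 * Y2 * fP + Y1 ^ 3 = gP)
    {p1 p2 p3 q1 q2 q3 r1 r2 r3 d1 d2 d3 : k}
    (hdet : p1 * (q2 * r3 - q3 * r2) - q1 * (p2 * r3 - p3 * r2) + r1 * (p2 * q3 - p3 * q2) ≠ 0)
    (hβ : ¬ (q1 = 0 ∧ r1 = 0 ∧ d1 = 0 ∧ p2 = 0 ∧ r2 = 0 ∧ d2 = 0 ∧ p3 = 0 ∧ q3 = 0 ∧ d3 = 0 ∧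
      p1 = r3 ^ 3 ∧ q2 = r3 ^ 2)) :
    Admissible (C p1 * Y1 + C q1 * Y2 + C r1 * Y3 + C d1)
      (C p2 * Y1 + C q2 * Y2 + C r2 * Y3 + C d2) (C p3 * Y1 + C q3 * Y2 + C r3 * Y3 + C d3) := by
  obtain ⟨γ1, l1, hγ1, hl1, H1, h11, h12, h13⟩ := T.exists_lead_linear hu p1 q1 r1 d1
    (by rintro ⟨rfl, rfl, rfl⟩; exact hdet (by ring))
  obtain ⟨γ2, l2, hγ2, hl2, H2, h21, h22, h23⟩ := T.exists_lead_linear hu p2 q2 r2 d2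
    (by rintro ⟨rfl, rfl, rfl⟩; exact hdet (by ring))
  obtain ⟨γ3, l3, hγ3, hl3, H3, h31, h32, h33⟩ := T.exists_lead_linear hu p3 q3 r3 d3
    (by rintro ⟨rfl, rfl, rfl⟩; exact hdet (by ring))
  by_cases hcan : γ1 + γ3 = 2 * γ2 ∧ l1 * l3 = l2 ^ 2
  · obtain ⟨hγ, hl⟩ := hcan
    have h : (γ1 = 1 ∧ γ2 = 1 ∧ γ3 = 1) ∨ (γ1 = 2 ∧ γ2 = 2 ∧ γ3 = 2) ∨
        (γ1 = 1 ∧ γ2 = 2 ∧ γ3 = 3) ∨ (γ1 = 3 ∧ γ2 = 2 ∧ γ3 = 1) ∨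
        (γ1 = 3 ∧ γ2 = 3 ∧ γ3 = 3) := by omega
    rcases h with ⟨rfl, rfl, rfl⟩ | ⟨rfl, rfl, rfl⟩ | ⟨rfl, rfl, rfl⟩ | ⟨rfl, rfl, rfl⟩ |
      ⟨rfl, rfl, rfl⟩
    · obtain ⟨rfl, rfl, -⟩ := h11 rfl
      obtain ⟨rfl, rfl, -⟩ := h21 rfl
      exact absurd (by ring) hdet
    · obtain ⟨rfl, -⟩ := h12 rfl
      obtain ⟨rfl, -⟩ := h22 rfl
      obtain ⟨rfl, -⟩ := h32 rfl
      exact absurd (by ring) hdet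
    · obtain ⟨rfl, rfl, rfl⟩ := h11 rfl
      obtain ⟨rfl, rfl⟩ := h22 rfl
      obtain rfl := h33 rfl
      have := admissible_type123 T hu hr hg (left_ne_zero_of_mul hl1) (left_ne_zero_of_mul hl2)
        (left_ne_zero_of_mul hl3)
        (mul_right_cancel₀ (pow_ne_zero 8 hu) (by linear_combination hl)) (e := p2) (p := q3)
        (q := p3) (d1 := d1) (d2 := d2) (d3 := d3)
        (fun ⟨h1, h2, h3, h4, h5, h6, h7, h8⟩ => hβ ⟨rfl, rfl, h6, h3, rfl, h7, h5, h4, h8, h1, h2⟩)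
      convert this using 1
      · simp
      · rw [map_zero]; ring
      · ring
    · obtain rfl := h13 rfl
      obtain ⟨rfl, rfl⟩ := h22 rfl
      obtain ⟨rfl, rfl, rfl⟩ := h31 rfl
      have := admissible_type321 T hu (left_ne_zero_of_mul hl1) (left_ne_zero_of_mul hl3)
        (b := q2) (mul_right_cancel₀ (pow_ne_zero 8 hu) (by linear_combination hl)) (e := p2)
        (p := q1)
        (q := p1) (d1 := d1) (d2 := d2) (d3 := d3)
      convert this using 1
      · ring
      · rw [map_zero]; ring
      · simp
    · obtain rfl := h13 rfl
      obtain rfl := h23 rfl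
      obtain rfl := h33 rfl
      exact admissible_type333' T hu hr (left_ne_zero_of_mul hl1) (left_ne_zero_of_mul hl2)
        (left_ne_zero_of_mul hl3)
        (mul_right_cancel₀ (pow_ne_zero 12 hu) (by linear_combination hl)) hdet
  · have h311 : γ1 ≤ γ2 + γ3 := by
      by_contra h
      obtain ⟨rfl, rfl, -⟩ := h21 (by omega)
      obtain ⟨rfl, rfl, -⟩ := h31 (by omega)
      exact hdet (by ring)
    have H13 := H1.mul H3
    have H22 := (H2.pow 2).const_mul (-1)
    rcases lt_trichotomy (γ1 + γ3) (2 * γ2) with h | h | h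
    · refine admissible_of_no_cancellation (M := 2 * γ2) H1 H2 H3
        ((H22.add_low H13 (by omega)).congr rfl (by ring) rfl ?_) (by omega) hγ1 hγ3.1 h311 hl3
        (mul_ne_zero (neg_ne_zero.2 one_ne_zero) (pow_ne_zero 2 hl2))
      rw [map_neg, map_one]; ring
    · refine admissible_of_no_cancellation (M := γ1 + γ3) (c := l1 * l3 - l2 ^ 2) H1 H2 H3
        (((H13.congr rfl (by ring) rfl rfl).add (H22.congr h.symm (by rw [h]; ring) rfl rfl)).congr
          rfl rfl (by ring) ?_) (by omega) hγ1 hγ3.1 h311 hl3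
        (sub_ne_zero.2 fun h' => hcan ⟨h, h'⟩)
      rw [map_neg, map_one]; ring
    · refine admissible_of_no_cancellation (M := γ1 + γ3) H1 H2 H3
        ((H13.add_low H22 (by omega)).congr rfl (by ring) rfl ?_) (by omega) hγ1 hγ3.1 h311 hl3
        (mul_ne_zero hl1 hl3)
      rw [map_neg, map_one]; ring

end Affine

theorem IsExpOf.leadTriple [CharZero k] {u : k}
    {φ : MvPolynomial (Fin 3) k ≃ₐ[k] MvPolynomial (Fin 3) k}
    (hφ : IsExpOf (fun h => u • Del h) φ) : LeadTriple u (φ (X 0)) (φ (X 1)) (φ (X 2)) where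
  lead1 := hφ.hasLead_x1
  lead2 := hφ.hasLead_x2
  lead3 := hφ.hasLead_x3
  rel := by simpa [fP] using hφ.apply_f
  cancel := by simpa [hφ.apply_f] using hφ.hasLead_x3f_add_x1x2

/-- The induction step: `φ ∘ α` preserves good leading terms for `α ∉ B`. -/
theorem HasGoodLead.map_exp_affine [CharZero k] {u : k} (hu : u ≠ 0)
    {φ α : MvPolynomial (Fin 3) k ≃ₐ[k] MvPolynomial (Fin 3) k}
    (hφ : IsExpOf (fun h => u • Del h) φ) (hα : IsAffine α) (hαB : α ∉ BSet)
    {h : MvPolynomial (Fin 3) k} (H : HasGoodLead h) : HasGoodLead (φ (α h)) := by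
  obtain ⟨A, b, hA, hAb⟩ := hα
  have hdet := hA.ne_zero
  rw [Matrix.det_fin_three] at hdet
  have hr : HasLead 1 1 (-u) (φ (X 1) * fP + φ (X 0) ^ 2) := by
    simpa [rP, hφ.apply_f] using hφ.hasLead_r
  have hg : φ (X 2) * fP ^ 2 + 2 * φ (X 0) * φ (X 1) * fP + φ (X 0) ^ 3 = gP := by
    have := hφ.apply_g
    nth_rw 1 [gP] at this
    simpa [hφ.apply_f, map_ofNat] using this
  have hφC : ∀ c, φ (C c) = C c := fun c => φ.commutes c
  have key := admissible_of_isUnit_det hφ.leadTriple hu hr hg (p1 := A 0 0) (q1 := A 1 0)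
    (r1 := A 2 0) (d1 := b 0) (p2 := A 0 1) (q2 := A 1 1) (r2 := A 2 1) (d2 := b 1)
    (p3 := A 0 2) (q3 := A 1 2) (r3 := A 2 2) (d3 := b 2)
    (fun h => hdet (by linear_combination h)) ?_
  · refine key ((α.trans φ : _ ≃ₐ[k] _) : _ →ₐ[k] _) ?_ ?_ ?_ h H <;>
    simp [hAb, Fin.sum_univ_three, hφC]
  · rintro ⟨q1, r1, d1, p2, r2, d2, p3, q3, d3, h1, h2⟩
    refine hαB ⟨A 2 2, ?_, ?_, ?_, ?_⟩
    · intro h0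
      exact hdet (by rw [q1, r1, h0]; simp [h1, h0])
    all_goals simp [hAb, Fin.sum_univ_three, q1, r1, d1, p2, r2, d2, p3, q3, d3, h1, h2]

theorem hasGoodLead_exp_X [CharZero k] {u : k} (hu : u ≠ 0)
    {φ : MvPolynomial (Fin 3) k ≃ₐ[k] MvPolynomial (Fin 3) k}
    (hφ : IsExpOf (fun h => u • Del h) φ) (i : Fin 3) : HasGoodLead (φ (X i)) := by
  fin_cases i
  · exact ⟨1, 2, _, le_rfl, le_rfl, pow_ne_zero _ hu, hφ.hasLead_x1⟩
  · exact ⟨2, 3, _, by omega, by omega, neg_ne_zero.2 (pow_ne_zero _ hu), hφ.hasLead_x2⟩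
  · exact ⟨3, 4, _, by omega, by omega, pow_ne_zero _ hu, hφ.hasLead_x3⟩

/-- The part of the composition to the right of `α_0` produces good leading terms. -/
theorem exists_hasGoodLead_prod [CharZero k] (s : ℕ) (u : Fin (s + 1) → k) (hu : ∀ i, u i ≠ 0)
    (φ α : Fin (s + 1) → (MvPolynomial (Fin 3) k ≃ₐ[k] MvPolynomial (Fin 3) k))
    (hφ : ∀ i, IsExpOf (fun h => u i • Del h) (φ i))
    (hα : ∀ i, i ≠ 0 → IsAffine (α i) ∧ α i ∉ BSet) (i : Fin 3) :
    ∃ h, HasGoodLead h ∧ (List.ofFn fun i => α i * φ i).prod (X i) = α 0 h := by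
  induction s with
  | zero => exact ⟨_, hasGoodLead_exp_X (hu 0) (hφ 0) i, by simp⟩
  | succ s ih =>
    obtain ⟨h, hh, heq⟩ := ih (fun j => u j.succ) (fun j => hu _) (fun j => φ j.succ)
      (fun j => α j.succ) (fun j => hφ _) (fun j _ => hα _ (Fin.succ_ne_zero j))
    obtain ⟨h1, h2⟩ := hα 1 (by simp)
    refine ⟨_, hh.map_exp_affine (hu 0) (hφ 0) h1 h2, ?_⟩
    rw [List.ofFn_succ, List.prod_cons, AlgEquiv.mul_apply, heq]
    rfl

/-- (Theorem 2 of the paper.)  For `s ≥ 1`, `u_1,…,u_s ∈ k^*`,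
`α_0 ∈ Aff_3(k)` and `α_1,…,α_{s-1} ∈ Aff_3(k) \ B`, the composition
`θ = α_0 ∘ φ_{u_1} ∘ α_1 ∘ φ_{u_2} ∘ ⋯ ∘ α_{s-1} ∘ φ_{u_s}` satisfies
`deg θ(x_i) ≥ 9` for `i = 1,2,3`. -/
theorem statement1 [CharZero k]
    (hln : ∀ h : MvPolynomial (Fin 3) k, ∃ l : ℕ, Del^[l] h = 0)
    (s : ℕ) (hs : 1 ≤ s)
    (u : Fin s → k) (hu : ∀ i, u i ≠ 0)
    (φ : Fin s → (MvPolynomial (Fin 3) k ≃ₐ[k] MvPolynomial (Fin 3) k))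
    (hφ : ∀ i, IsExpOf (fun h => u i • Del h) (φ i))
    (α : Fin s → (MvPolynomial (Fin 3) k ≃ₐ[k] MvPolynomial (Fin 3) k))
    (hα0 : IsAffine (α ⟨0, hs⟩))
    (hmid : ∀ i : Fin s, (i : ℕ) ≠ 0 → IsAffine (α i) ∧ α i ∉ BSet)
    (θ : MvPolynomial (Fin 3) k ≃ₐ[k] MvPolynomial (Fin 3) k)
    (hθ : θ = (List.ofFn fun i => α i * φ i).prod) :
    ∀ i : Fin 3, 9 ≤ (θ (X i)).totalDegree := by
  intro i
  obtain ⟨s, rfl⟩ : ∃ t, s = t + 1 := ⟨s - 1, by omega⟩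
  obtain ⟨h, ⟨m, n, c, hm, hn, hc, H⟩, heq⟩ := exists_hasGoodLead_prod s u hu φ α hφ
    (fun j hj => hmid j (fun h => hj (Fin.ext h))) i
  rw [hθ, heq]
  exact le_trans (by omega) (H.le_totalDegree hc (by omega) hα0)

end YasudaPaper
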